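/- Expansion of ks in terms of vs and ŝk with a free parameter a: for partitions μ ⊆ λ, ks_{λ/μ}(q,t) = (t/q)^{|λ|−|μ|} · ((a/q)_μ (a/t)_λ)/((a)_μ (a/q)_λ) · Σ_ν (−1)^{|λ|−|ν|} ((a)_ν/(a/t)_ν) vs_{λ/ν}(q,t) ŝk_{ν/μ}(q,t), as an identity of rational functions in q, t, a, where the sum is over all partitions ν with μ ⊆ ν ⊆ λ. -/

import Mathlib

/-!
Common framework: integer partitions, Gaussian binomials, Hall--Littlewood
Pieri coefficients, the ring of symmetric functions realized as polynomials
in the power sums, the Macdonald `(q,t)`-inner product, a characterisation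
of the Macdonald polynomials `P_λ(X;q,t)`, skew Macdonald polynomials,
plethystic evaluations and the various Pieri coefficients of
Konvalinka--Lauve and Warnaar.
-/

open scoped BigOperators

noncomputable section

namespace SkewPieriFormalization

/-- An integer partition, encoded as a finitely supported weakly decreasing
sequence of natural numbers; `part j` is the part `λ_{j+1}` (0-indexed). -/
structure Partition where
  part : ℕ →₀ ℕ
  antitone' : ∀ ⦃i j : ℕ⦄, i ≤ j → part j ≤ part i

namespace Partition

/-- Containment of Young diagrams: `μ ≤ λ` iff `μ_i ≤ λ_i` for all `i`. -/
instance : LE Partition := ⟨fun mu lam => ∀ j : ℕ, mu.part j ≤ lam.part j⟩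

/-- `|λ|`, the size (sum of the parts). -/
def size (lam : Partition) : ℕ := lam.part.sum fun _ k => k

/-- `l(λ)`, the number of (nonzero) parts. -/
def length (lam : Partition) : ℕ := lam.part.support.card

/-- `n(λ) = ∑_{i ≥ 1} (i-1) λ_i`. -/
def nstat (lam : Partition) : ℕ := lam.part.sum fun j k => j * k

/-- the `i`-th part `λ_i` (1-indexed). -/
def row (lam : Partition) (i : ℕ) : ℕ := lam.part (i - 1)

/-- the part `λ'_i = #{j : λ_j ≥ i}` of the conjugate partition (for `i ≥ 1`). -/
def conj (lam : Partition) (i : ℕ) : ℕ :=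
  (lam.part.support.filter fun j => i ≤ lam.part j).card

/-- the multiplicity `m_r(λ)` of `r` as a part of `λ`. -/
def mult (lam : Partition) (r : ℕ) : ℕ :=
  (lam.part.support.filter fun j => lam.part j = r).card

/-- `z_λ = ∏_{r ≥ 1} r^{m_r} m_r!`. -/
def zee (lam : Partition) : ℕ :=
  ∏ r ∈ Finset.Icc 1 (lam.part 0), r ^ lam.mult r * Nat.factorial (lam.mult r)

/-- the partial sum `λ_1 + ⋯ + λ_k`. -/
def psum (lam : Partition) (k : ℕ) : ℕ := ∑ j ∈ Finset.range k, lam.part j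

/-- dominance order: `λ ⊵ μ` (for `|λ| = |μ|`). -/
def Dominates (lam mu : Partition) : Prop :=
  mu.size = lam.size ∧ ∀ k : ℕ, mu.psum k ≤ lam.psum k

/-- the one-row partition `(r)`. -/
def single (r : ℕ) : Partition where
  part := Finsupp.single 0 r
  antitone' := by
    intro i j hij
    by_cases hj : j = 0
    · have : i = 0 := by omega
      simp [hj, this]
    · simp only [Finsupp.single_apply]
      split <;> split <;> omega

/-- the one-column partition `(1^m)`. -/
def column (m : ℕ) : Partition where
  part := Finsupp.onFinset (Finset.range m) (fun j => if j < m then 1 else 0)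
    (fun j h => by
      simp only [Finset.mem_range]
      by_contra hc
      simp [hc] at h)
  antitone' := by
    intro i j hij
    simp only [Finsupp.onFinset_apply]
    split <;> split <;> omega

end Partition

variable {F : Type*} [Field F]

/-- the `t`-integer `[n]_t = 1 + t + ⋯ + t^{n-1}`. -/
def qint (t : F) (n : ℕ) : F := ∑ j ∈ Finset.range n, t ^ j

/-- the `t`-factorial. -/
def qfac (t : F) (n : ℕ) : F := ∏ j ∈ Finset.range n, qint t (j + 1)

/-- the Gaussian binomial coefficient `[n choose k]_t`; it vanishes
unless `0 ≤ k ≤ n`. -/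
def qbinom (t : F) (n k : ℤ) : F :=
  if 0 ≤ k ∧ k ≤ n then qfac t n.toNat / (qfac t k.toNat * qfac t (n - k).toNat) else 0

/-- the Hall--Littlewood Pieri coefficient
`ψ'_{λ/μ}(t) = ∏_{i ≥ 1} [λ'_i - λ'_{i+1} choose λ'_i - μ'_i]_t`;
it vanishes unless `μ ⊆ λ` with `λ - μ` a vertical strip. -/
def vsHL (t : F) (lam mu : Partition) : F :=
  ∏ i ∈ Finset.Icc 1 (lam.part 0 + mu.part 0),
    qbinom t ((lam.conj i : ℤ) - lam.conj (i + 1)) ((lam.conj i : ℤ) - mu.conj i)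

open Classical in
/-- the Hall--Littlewood Pieri coefficient `φ_{λ/μ}(t)`, equal to
`∏ (1 - t^{λ'_i - λ'_{i+1}})` over those `i ≥ 1` with `λ'_i = μ'_i + 1` and
`λ'_{i+1} = μ'_{i+1}`, when `μ ⊆ λ` with `λ - μ` a horizontal strip, and
vanishing otherwise. -/
def hsHL (t : F) (lam mu : Partition) : F :=
  if ∀ i : ℕ, mu.conj i ≤ lam.conj i ∧ lam.conj i ≤ mu.conj i + 1 then
    ∏ i ∈ Finset.Icc 1 (lam.part 0 + mu.part 0),
      if lam.conj i = mu.conj i + 1 ∧ lam.conj (i + 1) = mu.conj (i + 1) then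
        1 - t ^ (lam.conj i - lam.conj (i + 1))
      else 1
  else 0

/-- `n(λ/μ) = ∑_{i ≥ 1} C(λ'_i - μ'_i, 2)`. -/
def nskew (lam mu : Partition) : ℕ :=
  ∑ i ∈ Finset.Icc 1 (lam.part 0 + mu.part 0), Nat.choose (lam.conj i - mu.conj i) 2

/-- the Konvalinka--Lauve coefficient
`sk_{λ/μ}(t) = t^{n(λ/μ)} ∏_{i ≥ 1} [λ'_i - μ'_{i+1} choose λ'_i - μ'_i]_t`;
it vanishes unless `μ ⊆ λ`. -/
def skHL (t : F) (lam mu : Partition) : F :=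
  t ^ nskew lam mu *
    ∏ i ∈ Finset.Icc 1 (lam.part 0 + mu.part 0),
      qbinom t ((lam.conj i : ℤ) - mu.conj (i + 1)) ((lam.conj i : ℤ) - mu.conj i)

/-- The ring of symmetric functions over `F`, realized as the polynomial ring
in the power sums: the variable `n` is the power sum `p_{n+1}`. -/
abbrev Sym (F : Type*) [Field F] := MvPolynomial ℕ F

/-- the power sum product `p_λ = p_{λ_1} p_{λ_2} ⋯`. -/
def pprod (lam : Partition) : Sym F :=
  ∏ j ∈ lam.part.support, MvPolynomial.X (lam.part j - 1)

/-- Macdonald's `(q,t)`-deformation of the Hall inner product, for which the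
power sums are orthogonal with `⟨p_λ, p_λ⟩ = z_λ ∏_i (1-q^{λ_i})/(1-t^{λ_i})`. -/
def innerQT (q t : F) (f g : Sym F) : F :=
  ∑ d ∈ f.support,
    f.coeff d * g.coeff d *
      d.prod fun n m =>
        (((n : F) + 1) ^ m * (Nat.factorial m : F)) *
          ((1 - q ^ (n + 1)) / (1 - t ^ (n + 1))) ^ m

/-- the complete homogeneous symmetric function `h_r = ∑_{|κ| = r} z_κ⁻¹ p_κ`. -/
def hsym (F : Type*) [Field F] (r : ℕ) : Sym F :=
  ∑ᶠ (k : Partition) (_ : k.size = r), ((k.zee : F))⁻¹ • (pprod k : Sym F)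

/-- the elementary symmetric function `e_r = ∑_{|κ| = r} (-1)^{r - l(κ)} z_κ⁻¹ p_κ`. -/
def esym (F : Type*) [Field F] (r : ℕ) : Sym F :=
  ∑ᶠ (k : Partition) (_ : k.size = r),
    ((-1 : F) ^ (r - k.length) * (k.zee : F)⁻¹) • (pprod k : Sym F)

/-- `h_μ = h_{μ_1} h_{μ_2} ⋯`. -/
def hprod (F : Type*) [Field F] (mu : Partition) : Sym F :=
  ∏ j ∈ mu.part.support, hsym F (mu.part j)

/-- Characterisation of the (monic) Macdonald polynomial family
`λ ↦ P_λ(X;q,t)`: the `P_λ` are pairwise orthogonal for the `(q,t)`-inner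
product, and `P_λ = m_λ + ∑_{μ ⊲ λ} u_{λμ} m_μ` is unitriangular with respect
to dominance order in the monomial basis.  Since `{h_μ}` is the dual basis of
`{m_μ}` for the classical Hall pairing (the case `q = t`), unitriangularity is
expressed by the last two conditions.  For `q = 0` this characterises the
Hall--Littlewood polynomials `P_λ(X;t)`. -/
def IsMacdonald (q t : F) (P : Partition → Sym F) : Prop :=
  (∀ lam mu, lam ≠ mu → innerQT q t (P lam) (P mu) = 0) ∧
  (∀ lam, innerQT t t (P lam) (hprod F lam) = 1) ∧
  (∀ lam mu, ¬ Partition.Dominates lam mu → innerQT t t (P lam) (hprod F mu) = 0)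

/-- `b_λ = ⟨P_λ, P_λ⟩⁻¹`. -/
def bnorm (q t : F) (P : Partition → Sym F) (lam : Partition) : F :=
  (innerQT q t (P lam) (P lam))⁻¹

/-- `Q_λ = b_λ P_λ`. -/
def macQ (q t : F) (P : Partition → Sym F) (lam : Partition) : Sym F :=
  bnorm q t P lam • P lam

/-- the skew Macdonald polynomial `Q_{λ/μ}`, defined by
`⟨Q_{λ/μ}, P_ν⟩ = ⟨Q_λ, P_μ P_ν⟩`. -/
def skewQ (q t : F) (P : Partition → Sym F) (lam mu : Partition) : Sym F :=
  ∑ᶠ nu : Partition, innerQT q t (macQ q t P lam) (P mu * P nu) • macQ q t P nu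

/-- the skew Macdonald polynomial `P_{λ/μ}`, defined by
`⟨P_{λ/μ}, Q_ν⟩ = ⟨P_λ, Q_μ Q_ν⟩`. -/
def skewP (q t : F) (P : Partition → Sym F) (lam mu : Partition) : Sym F :=
  ∑ᶠ nu : Partition, innerQT q t (P lam) (macQ q t P mu * macQ q t P nu) • P nu

/-- the Littlewood--Richardson coefficient `f_{μν}^λ(q,t) = ⟨Q_λ, P_μ P_ν⟩`,
so that `P_μ P_ν = ∑_λ f_{μν}^λ P_λ`. -/
def lr (q t : F) (P : Partition → Sym F) (mu nu lam : Partition) : F :=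
  innerQT q t (macQ q t P lam) (P mu * P nu)

/-- the plethystic evaluation `f ↦ f((a-b)/(1-t))`, determined on power sums
by `p_r ↦ (a^r - b^r)/(1 - t^r)`. -/
def plethAB (t a b : F) (f : Sym F) : F :=
  MvPolynomial.eval (fun n => (a ^ (n + 1) - b ^ (n + 1)) / (1 - t ^ (n + 1))) f

/-- `vs_{λ/μ}(q,t) = ψ'_{λ/μ}(q,t) = (-1)^{|λ|-|μ|} Q_{λ/μ}((q-1)/(1-t))`. -/
def vsM (q t : F) (P : Partition → Sym F) (lam mu : Partition) : F :=
  (-1 : F) ^ ((lam.size : ℤ) - (mu.size : ℤ)) * plethAB t q 1 (skewQ q t P lam mu)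

/-- `sk_{λ/μ}(q,t) = Q_{λ/μ}((1-q)/(1-t))`. -/
def skM (q t : F) (P : Partition → Sym F) (lam mu : Partition) : F :=
  plethAB t 1 q (skewQ q t P lam mu)

/-- `ŝk_{λ/μ}(q,t) = Q_{λ/μ}((1-q/t)/(1-t))`. -/
def skHatM (q t : F) (P : Partition → Sym F) (lam mu : Partition) : F :=
  plethAB t 1 (q / t) (skewQ q t P lam mu)

/-- `hs_{λ/μ}(q,t) = φ_{λ/μ}(q,t) = Q_{λ/μ}(1)`, the plethystic evaluation
`p_r ↦ 1`. -/
def hsM (q t : F) (P : Partition → Sym F) (lam mu : Partition) : F :=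
  MvPolynomial.eval (fun _ => (1 : F)) (skewQ q t P lam mu)

/-- `ks_{λ/μ}(q,t) = Q_{λ/μ}(-1)`, the plethystic evaluation `p_r ↦ -1`. -/
def ksM (q t : F) (P : Partition → Sym F) (lam mu : Partition) : F :=
  MvPolynomial.eval (fun _ => (-1 : F)) (skewQ q t P lam mu)

/-- the finite `q`-Pochhammer symbol `(a;q)_k = ∏_{j=0}^{k-1}(1 - a q^j)`. -/
def qPochN (qq a : F) (k : ℕ) : F := ∏ j ∈ Finset.range k, (1 - a * qq ^ j)

/-- the `q`-Pochhammer symbol `(a;q)_k = (a;q)_∞/(a q^k;q)_∞` for `k ∈ ℤ`;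
for `k = -m < 0` it equals `1/∏_{i=1}^m (1 - a q^{-i})`. -/
def qPochZ (qq a : F) (k : ℤ) : F :=
  if 0 ≤ k then qPochN qq a k.toNat
  else (∏ j ∈ Finset.range (-k).toNat, (1 - a * (qq⁻¹) ^ (j + 1)))⁻¹

/-- `(a)_λ = (a;q,t)_λ = ∏_{i ≥ 1} (a t^{1-i}; q)_{λ_i}`. -/
def qtPoch (qq tt a : F) (lam : Partition) : F :=
  ∏ j ∈ lam.part.support, qPochN qq (a * tt ^ (-(j : ℤ))) (lam.part j)

/-- the degree (as a symmetric function) of a power-sum exponent vector. -/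
def wt (d : ℕ →₀ ℕ) : ℕ := d.sum fun n m => (n + 1) * m

/-- the degree-`r` homogeneous component of `∏_x (bx;q)_∞/(ax;q)_∞`, namely
`∑_{|κ| = r} z_κ⁻¹ ∏_i (a^{κ_i} - b^{κ_i})/(1 - q^{κ_i}) · p_κ`. -/
def prodComp (a b qq : F) (r : ℕ) : Sym F :=
  ∑ᶠ (k : Partition) (_ : k.size = r),
    ((k.zee : F)⁻¹ *
        ∏ j ∈ k.part.support,
          (a ^ k.part j - b ^ k.part j) / (1 - qq ^ k.part j)) • (pprod k : Sym F)

/-- `∏_x (bx;q)_∞/(ax;q)_∞`, where `(cx;q)_∞ = ∏_{j ≥ 0}(1 - cx q^j)`, as a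
formal power series in the power sums. -/
def prodSeries (a b qq : F) : MvPowerSeries ℕ F :=
  fun d => MvPolynomial.coeff d (prodComp a b qq (wt d))

/-- the formal (possibly infinite) sum `∑_i c_i g_i` of symmetric functions,
as a formal power series in the power sums. -/
def sumSeries {ι : Type*} (c : ι → F) (g : ι → Sym F) : MvPowerSeries ℕ F :=
  fun d => ∑ᶠ i : ι, c i * MvPolynomial.coeff d (g i)

/-- `ℚ(t)` -/
abbrev F1 : Type := RatFunc ℚ
/-- `ℚ(t)(q)` -/
abbrev F2 : Type := RatFunc F1
/-- `ℚ(t)(q)(a)` -/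
abbrev F3 : Type := RatFunc F2
/-- `ℚ(t)(q)(a)(b)` -/
abbrev F4 : Type := RatFunc F3

instance : Field F2 := inferInstance
instance : Field F3 := inferInstance
instance : Field F4 := inferInstance

/-- the indeterminate `t` in `ℚ(t)`. -/
def t1 : F1 := RatFunc.X
/-- the indeterminate `q` in `ℚ(t)(q)`. -/
def q2 : F2 := RatFunc.X
/-- the indeterminate `t` in `ℚ(t)(q)`. -/
def t2 : F2 := RatFunc.C t1
/-- the indeterminate `a` in `ℚ(t)(q)(a)`. -/
def a3 : F3 := RatFunc.X
/-- the indeterminate `q` in `ℚ(t)(q)(a)`. -/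
def q3 : F3 := RatFunc.C q2
/-- the indeterminate `t` in `ℚ(t)(q)(a)`. -/
def t3 : F3 := RatFunc.C t2
/-- the indeterminate `b` in `ℚ(t)(q)(a)(b)`. -/
def b4 : F4 := RatFunc.X
/-- the indeterminate `a` in `ℚ(t)(q)(a)(b)`. -/
def a4 : F4 := RatFunc.C a3
/-- the indeterminate `q` in `ℚ(t)(q)(a)(b)`. -/
def q4 : F4 := RatFunc.C q3
/-- the indeterminate `t` in `ℚ(t)(q)(a)(b)`. -/
def t4 : F4 := RatFunc.C t3



open MvPolynomial in
theorem prod_add_single (g : ℕ → ℕ → F) (hg : ∀ n, g n 0 = 1) (d : ℕ →₀ ℕ) (n : ℕ) :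
    (d + Finsupp.single n 1).prod g = g n (d n + 1) * (d.erase n).prod g ∧
      d.prod g = g n (d n) * (d.erase n).prod g := by
  constructor
  · rw [← Finsupp.mul_prod_erase' (d + Finsupp.single n 1) n g (fun i => hg i)]
    congr 1
    · simp
    · congr 1
      ext i
      by_cases h : i = n
      · simp [h]
      · simp [Finsupp.erase_ne h, Finsupp.single_apply, Ne.symm h]
  · rw [← Finsupp.mul_prod_erase' d n g (fun i => hg i)]

theorem wt_add (d e : ℕ →₀ ℕ) : wt (d + e) = wt d + wt e := by
  unfold wt
  rw [Finsupp.sum_add_index'] <;> intros <;> ring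

theorem wt_single (n m : ℕ) : wt (Finsupp.single n m) = (n + 1) * m := by
  unfold wt
  rw [Finsupp.sum_single_index]; simp

theorem wt_zero : wt 0 = 0 := by simp [wt]

theorem le_wt (d : ℕ →₀ ℕ) (n : ℕ) : (n + 1) * d n ≤ wt d := by
  by_cases h : n ∈ d.support
  · exact Finset.single_le_sum (f := fun n => (n + 1) * d n) (fun _ _ => Nat.zero_le _) h
  · simp at h; simp [h]

theorem eq_zero_of_wt (d : ℕ →₀ ℕ) (h : wt d = 0) : d = 0 := by
  ext n
  have := le_wt d n
  rw [h] at this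
  simp at this
  simpa using this

theorem finite_wt_le (k : ℕ) : {d : ℕ →₀ ℕ | wt d ≤ k}.Finite := by
  apply (Set.finite_Icc (0 : ℕ →₀ ℕ) (∑ i ∈ Finset.range k, Finsupp.single i k)).subset
  intro d hd
  refine ⟨bot_le, fun n => ?_⟩
  have h1 := le_wt d n
  change wt d ≤ k at hd
  rw [Finsupp.finsetSum_apply]
  simp only [Finsupp.single_apply, Finset.sum_ite_eq', Finset.mem_range]
  by_cases h0 : d n = 0
  · simp [h0]
  · have : n + 1 ≤ wt d := le_trans (Nat.le_mul_of_pos_right _ (Nat.pos_of_ne_zero h0)) h1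
    have : d n ≤ wt d := le_trans (Nat.le_mul_of_pos_left _ (Nat.succ_pos n)) h1
    split_ifs <;> omega

theorem finite_wt (k : ℕ) : {d : ℕ →₀ ℕ | wt d = k}.Finite :=
  (finite_wt_le k).subset (fun _ h => le_of_eq h)

/-- weight of a monomial in the form `ip`. -/
def wgt (w : ℕ → F) (d : ℕ →₀ ℕ) : F := d.prod fun n m => w n ^ m * (m.factorial : F)

theorem wgt_add_single (w : ℕ → F) (d : ℕ →₀ ℕ) (n : ℕ) :
    wgt w (d + Finsupp.single n 1) = wgt w d * w n * (d n + 1) := by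
  obtain ⟨h1, h2⟩ := prod_add_single (fun n m => w n ^ m * (m.factorial : F)) (by simp) d n
  unfold wgt
  rw [h1, h2, Nat.factorial_succ]
  push_cast
  ring

theorem wgt_ne_zero [CharZero F] (w : ℕ → F) (hw : ∀ n, w n ≠ 0) (d : ℕ →₀ ℕ) : wgt w d ≠ 0 := by
  unfold wgt Finsupp.prod
  rw [Finset.prod_ne_zero_iff]
  intro n _
  exact mul_ne_zero (pow_ne_zero _ (hw n)) (Nat.cast_ne_zero.2 (Nat.factorial_ne_zero _))

/-- bilinear form with power sums orthogonal. -/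
def ip (w : ℕ → F) : Sym F →ₗ[F] Sym F →ₗ[F] F :=
  (MvPolynomial.basisMonomials ℕ F).constr F
    (fun d => wgt w d • MvPolynomial.lcoeff F d)

theorem ip_monomial (w : ℕ → F) (d : ℕ →₀ ℕ) (c : F) (g : Sym F) :
    ip w (MvPolynomial.monomial d c) g = c * (wgt w d * g.coeff d) := by
  have : MvPolynomial.monomial d c = c • (MvPolynomial.basisMonomials ℕ F d) := by
    simp [MvPolynomial.smul_monomial]
  rw [this, map_smul, ip, Module.Basis.constr_basis]
  simp

theorem ip_apply (w : ℕ → F) (f g : Sym F) :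
    ip w f g = ∑ d ∈ f.support, f.coeff d * g.coeff d * wgt w d := by
  conv_lhs => rw [f.as_sum]
  rw [map_sum, LinearMap.sum_apply]
  refine Finset.sum_congr rfl fun d _ => ?_
  rw [ip_monomial]; ring

theorem ip_symm (w : ℕ → F) (f g : Sym F) : ip w f g = ip w g f := by
  induction f using MvPolynomial.induction_on' with
  | add p q hp hq => rw [map_add, map_add, LinearMap.add_apply, hp, hq]
  | monomial d c =>
    induction g using MvPolynomial.induction_on' with
    | add p q hp hq => rw [map_add, map_add, LinearMap.add_apply, hp, hq]
    | monomial e b =>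
      classical
      rw [ip_monomial, ip_monomial, MvPolynomial.coeff_monomial, MvPolynomial.coeff_monomial]
      by_cases h : d = e
      · subst h; simp; ring
      · simp [h, Ne.symm h]

theorem ip_monomial_right (w : ℕ → F) (d : ℕ →₀ ℕ) (c : F) (g : Sym F) :
    ip w g (MvPolynomial.monomial d c) = c * (wgt w d * g.coeff d) := by
  rw [ip_symm, ip_monomial]

theorem ip_nondeg [CharZero F] (w : ℕ → F) (hw : ∀ n, w n ≠ 0) (f : Sym F)
    (h : ∀ g, ip w f g = 0) : f = 0 := by
  ext d
  have := h (MvPolynomial.monomial d 1)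
  rw [ip_monomial_right] at this
  simpa [wgt_ne_zero w hw d] using this

theorem ip_one_left (w : ℕ → F) (g : Sym F) : ip w 1 g = g.coeff 0 := by
  have : (1 : Sym F) = MvPolynomial.monomial 0 1 := rfl
  rw [this, ip_monomial]
  simp [wgt]

theorem ip_X_mul (w : ℕ → F) (n : ℕ) (f g : Sym F) :
    ip w (MvPolynomial.X n * f) g = w n * ip w f (MvPolynomial.pderiv n g) := by
  induction f using MvPolynomial.induction_on' with
  | add p q hp hq => rw [mul_add, map_add, map_add, LinearMap.add_apply, LinearMap.add_apply, hp, hq, mul_add]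
  | monomial d c =>
    have : MvPolynomial.X n * MvPolynomial.monomial d c
        = MvPolynomial.monomial (d + Finsupp.single n 1) c := by
      rw [MvPolynomial.X, MvPolynomial.monomial_mul, one_mul, add_comm]
    rw [this, ip_monomial, ip_monomial, MvPolynomial.coeff_pderiv, wgt_add_single]
    ring

theorem innerQT_eq (q t : F) (f g : Sym F) :
    innerQT q t f g =
      ip (fun n => ((n : F) + 1) * ((1 - q ^ (n + 1)) / (1 - t ^ (n + 1)))) f g := by
  rw [ip_apply]
  unfold innerQT wgt
  refine Finset.sum_congr rfl fun d _ => ?_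
  congr 1
  refine Finset.prod_congr rfl fun n _ => ?_
  beta_reduce
  rw [mul_pow]; ring

/-- coefficients of the kernel. -/
def kc (a : ℕ → F) (d : ℕ →₀ ℕ) : F :=
  d.prod fun n m => a n ^ m / (((n : F) + 1) ^ m * (m.factorial : F))

theorem kc_add_single [CharZero F] (a : ℕ → F) (d : ℕ →₀ ℕ) (n : ℕ) :
    kc a (d + Finsupp.single n 1) * (d n + 1) = (a n / (n + 1)) * kc a d := by
  obtain ⟨h1, h2⟩ := prod_add_single
    (fun n m => a n ^ m / (((n : F) + 1) ^ m * (m.factorial : F))) (by simp) d n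
  unfold kc
  rw [h1, h2, Nat.factorial_succ]
  have h3 : (d n : F) + 1 ≠ 0 := Nat.cast_add_one_ne_zero _
  have h4 : (n : F) + 1 ≠ 0 := Nat.cast_add_one_ne_zero _
  have h5 : ((d n).factorial : F) ≠ 0 := Nat.cast_ne_zero.2 (Nat.factorial_ne_zero _)
  push_cast
  field_simp
  ring

/-- degree `k` component of `exp (∑ a_n p_{n+1} / (n+1))`. -/
def K (a : ℕ → F) (k : ℕ) : Sym F :=
  ∑ d ∈ (finite_wt k).toFinset, MvPolynomial.monomial d (kc a d)

theorem coeff_K (a : ℕ → F) (k : ℕ) (d : ℕ →₀ ℕ) :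
    (K a k).coeff d = if wt d = k then kc a d else 0 := by
  classical
  unfold K
  rw [MvPolynomial.coeff_sum]
  simp only [MvPolynomial.coeff_monomial]
  rw [Finset.sum_ite_eq']
  simp

theorem K_zero (a : ℕ → F) : K a 0 = 1 := by
  classical
  ext d
  rw [coeff_K, MvPolynomial.coeff_one]
  by_cases h : d = 0
  · subst h; simp [wt_zero, kc]
  · rw [if_neg (fun h' => h (eq_zero_of_wt d h')), if_neg (Ne.symm h)]

theorem coeff_zero_K (a : ℕ → F) (k : ℕ) : (K a k).coeff 0 = if k = 0 then 1 else 0 := by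
  rw [coeff_K, wt_zero]
  by_cases h : k = 0
  · subst h; simp [kc]
  · simp [h, Ne.symm h]

/-- K with an integer-like shift: `K (k - j)` or zero. -/
def Ks (a : ℕ → F) (k j : ℕ) : Sym F := if j ≤ k then K a (k - j) else 0

theorem pderiv_K [CharZero F] (a : ℕ → F) (k n : ℕ) :
    MvPolynomial.pderiv n (K a k) = (a n / (n + 1)) • Ks a k (n + 1) := by
  ext d
  rw [MvPolynomial.coeff_pderiv, coeff_K, wt_add, wt_single, MvPolynomial.coeff_smul, Ks]
  by_cases h : n + 1 ≤ k
  · rw [if_pos h, coeff_K]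
    by_cases h' : wt d = k - (n + 1)
    · rw [if_pos h', if_pos (by omega), kc_add_single]; rfl
    · rw [if_neg h', if_neg (by omega)]; simp
  · rw [if_neg h, if_neg (by omega)]; simp

/-- polynomials with zero derivatives and zero constant term vanish. -/
theorem eq_zero_of_pderiv [CharZero F] (f : Sym F) (h0 : f.coeff 0 = 0)
    (h : ∀ n, MvPolynomial.pderiv n f = 0) : f = 0 := by
  ext d
  by_cases hd : d = 0
  · subst hd; simpa using h0
  · obtain ⟨n, hn⟩ := Finsupp.support_nonempty_iff.2 hd
    have h1 := congrArg (MvPolynomial.coeff (d - Finsupp.single n 1)) (h n)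
    rw [MvPolynomial.coeff_pderiv] at h1
    have h2 : d - Finsupp.single n 1 + Finsupp.single n 1 = d := by
      apply tsub_add_cancel_of_le
      rw [Finsupp.single_le_iff]
      exact Nat.one_le_iff_ne_zero.2 (Finsupp.mem_support_iff.1 hn)
    rw [h2] at h1
    rw [MvPolynomial.coeff_zero] at h1
    rw [MvPolynomial.coeff_zero]
    exact (mul_eq_zero.1 h1).resolve_right (Nat.cast_add_one_ne_zero _)

/-- Euler recursion. -/
theorem K_euler [CharZero F] (a : ℕ → F) (k : ℕ) :
    (k : F) • K a k = ∑ n ∈ Finset.range k, a n • (MvPolynomial.X n * K a (k - (n + 1))) := by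
  induction k using Nat.strong_induction_on with
  | _ k ih =>
  rw [← sub_eq_zero]
  apply eq_zero_of_pderiv
  · rw [MvPolynomial.coeff_sub, MvPolynomial.coeff_smul, coeff_zero_K, MvPolynomial.coeff_sum]
    rw [Finset.sum_eq_zero]
    · by_cases h : k = 0 <;> simp [h]
    · intro n _
      simp [MvPolynomial.coeff_X_mul']
  · intro m
    rw [map_sub, Derivation.map_smul, pderiv_K, map_sum, sub_eq_zero]
    have hterm : ∀ n ∈ Finset.range k,
        MvPolynomial.pderiv m (a n • (MvPolynomial.X n * K a (k - (n + 1)))) =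
          (if n = m then a m • K a (k - (m + 1)) else 0) +
            (a m / (m + 1)) • (a n • (MvPolynomial.X n * Ks a (k - (n + 1)) (m + 1))) := by
      intro n _
      rw [Derivation.map_smul, Derivation.leibniz, pderiv_K, MvPolynomial.pderiv_X]
      by_cases h : n = m
      · subst h
        simp only [Pi.single_eq_same, if_true, smul_eq_mul, mul_one, smul_add, mul_smul_comm]
        rw [add_comm]
        congr 1
        rw [smul_comm]
      · simp only [smul_eq_mul, if_neg h, zero_add, Pi.single_apply, if_neg (Ne.symm h), mul_zero, add_zero,
          mul_smul_comm]
        rw [smul_comm]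
    rw [Finset.sum_congr rfl hterm, Finset.sum_add_distrib, Finset.sum_ite_eq', ← Finset.smul_sum]
    by_cases h : m < k
    · rw [if_pos (Finset.mem_range.2 h)]
      have hs : ∑ n ∈ Finset.range k, a n • (MvPolynomial.X n * Ks a (k - (n + 1)) (m + 1))
          = ∑ n ∈ Finset.range (k - (m + 1)), a n • (MvPolynomial.X n * K a (k - (m + 1) - (n + 1))) := by
        symm
        rw [← Finset.sum_subset (s₁ := Finset.range (k - (m + 1)))
          (Finset.range_mono (Nat.sub_le _ _))]
        · refine Finset.sum_congr rfl fun n hn => ?_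
          rw [Finset.mem_range] at hn
          rw [Ks, if_pos (by omega)]
          congr 3; omega
        · intro n hn hn'
          rw [Finset.mem_range] at hn hn'
          rw [Ks, if_neg (by omega)]; simp
      rw [hs, ← ih (k - (m + 1)) (by omega), Ks, if_pos (by omega : m + 1 ≤ k), smul_smul, smul_smul,
        ← add_smul]
      congr 1
      have h4 : (m : F) + 1 ≠ 0 := Nat.cast_add_one_ne_zero _
      rw [Nat.cast_sub (by omega)]
      push_cast
      field_simp
      ring
    · rw [if_neg (by simpa using h), Finset.sum_eq_zero, Ks, if_neg (by omega)]
      · simp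
      · intro n hn
        rw [Ks, if_neg (by omega)]; simp

section ShiftPart
set_option linter.unusedSectionVars false
variable [CharZero F]

/-- the shift `p_{n+1} ↦ p_{n+1} + b_n z^{n+1}`. -/
def tau (b : ℕ → F) : Sym F →ₐ[F] Polynomial (Sym F) :=
  MvPolynomial.aeval (fun n => Polynomial.C (MvPolynomial.X n) +
    Polynomial.C (MvPolynomial.C (b n)) * Polynomial.X ^ (n + 1))

/-- the coefficient of `z^k` in the shift. -/
def T (b : ℕ → F) (k : ℕ) : Sym F →ₗ[F] Sym F :=
  ((Polynomial.lcoeff (Sym F) k).restrictScalars F) ∘ₗ (tau b).toLinearMap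

theorem T_def (b : ℕ → F) (k : ℕ) (f : Sym F) : T b k f = (tau b f).coeff k := rfl

/-- shifted version of `T`. -/
def Ts (b : ℕ → F) (k j : ℕ) : Sym F →ₗ[F] Sym F := if j ≤ k then T b (k - j) else 0

theorem T_X_mul (b : ℕ → F) (k n : ℕ) (f : Sym F) :
    T b k (MvPolynomial.X n * f) = MvPolynomial.X n * T b k f + b n • Ts b k (n + 1) f := by
  simp only [T_def, map_mul, Ts]
  rw [show tau b (MvPolynomial.X n) = Polynomial.C (MvPolynomial.X n) +
    Polynomial.C (MvPolynomial.C (b n)) * Polynomial.X ^ (n + 1) by simp [tau]]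
  rw [add_mul, Polynomial.coeff_add, Polynomial.coeff_C_mul, mul_assoc, Polynomial.coeff_C_mul,
    Polynomial.coeff_X_pow_mul']
  split_ifs with h
  · rw [T_def, MvPolynomial.smul_eq_C_mul]
  · simp

theorem T_C (b : ℕ → F) (k : ℕ) (c : F) :
    T b k (MvPolynomial.C c) = if k = 0 then MvPolynomial.C c else 0 := by
  rw [T_def]
  have : tau b (MvPolynomial.C c) = Polynomial.C (MvPolynomial.C c) := by
    simp [tau]
  rw [this, Polynomial.coeff_C]

theorem sym_induction {p : Sym F → Prop} (f : Sym F) (hC : ∀ c, p (MvPolynomial.C c))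
    (hadd : ∀ f g, p f → p g → p (f + g)) (hX : ∀ n f, p f → p (MvPolynomial.X n * f)) : p f := by
  induction f using MvPolynomial.induction_on with
  | C c => exact hC c
  | add f g hf hg => exact hadd f g hf hg
  | mul_X f n hf => rw [mul_comm]; exact hX n f hf

theorem T_zero (b : ℕ → F) (f : Sym F) : T b 0 f = f := by
  induction f using sym_induction with
  | hC c => simp [T_C]
  | hadd f g hf hg => rw [map_add, hf, hg]
  | hX n f hf => rw [T_X_mul, hf]; simp [Ts]

theorem T_comm (a b : ℕ → F) (f : Sym F) : ∀ i j, T a i (T b j f) = T b j (T a i f) := by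
  induction f using sym_induction with
  | hC c =>
    intro i j
    rw [T_C, T_C]
    split_ifs <;> simp [T_C, *]
  | hadd f g hf hg => intro i j; simp only [map_add, hf, hg]
  | hX n f hf =>
    intro i j
    simp only [T_X_mul, map_add, map_smul, Ts]
    split_ifs
    · simp only [hf]; abel
    · simp only [hf, LinearMap.zero_apply, map_zero]; abel
    · simp only [hf, LinearMap.zero_apply, map_zero]; abel
    · simp only [hf, LinearMap.zero_apply, map_zero]; abel

theorem sum_antidiag_shift {M : Type*} [AddCommMonoid M] (G : ℕ → ℕ → M) (k m : ℕ) :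
    (∑ x ∈ Finset.HasAntidiagonal.antidiagonal k, if m ≤ x.1 then G (x.1 - m) x.2 else 0) =
      if m ≤ k then ∑ x ∈ Finset.HasAntidiagonal.antidiagonal (k - m), G x.1 x.2 else 0 := by
  split_ifs with h
  · rw [← Finset.sum_filter, Finset.Nat.antidiagonal_filter_le_fst_of_le h, Finset.sum_map]
    refine Finset.sum_congr rfl fun x _ => ?_
    simp
  · apply Finset.sum_eq_zero
    intro x hx
    rw [Finset.HasAntidiagonal.mem_antidiagonal] at hx
    rw [if_neg (by omega)]

theorem sum_antidiag_shift' {M : Type*} [AddCommMonoid M] (G : ℕ → ℕ → M) (k m : ℕ) :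
    (∑ x ∈ Finset.HasAntidiagonal.antidiagonal k, if m ≤ x.2 then G x.1 (x.2 - m) else 0) =
      if m ≤ k then ∑ x ∈ Finset.HasAntidiagonal.antidiagonal (k - m), G x.1 x.2 else 0 := by
  have := sum_antidiag_shift (fun i j => G j i) k m
  rw [← Finset.Nat.sum_antidiagonal_swap] at this
  rw [← Finset.Nat.sum_antidiagonal_swap (n := k - m)] at this
  exact this

theorem T_add (a b : ℕ → F) (f : Sym F) : ∀ k, T (fun n => a n + b n) k f =
    ∑ x ∈ Finset.HasAntidiagonal.antidiagonal k, T a x.1 (T b x.2 f) := by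
  induction f using sym_induction with
  | hC c =>
    intro k
    rw [T_C]
    split_ifs with h
    · subst h; simp [T_C]
    · symm
      apply Finset.sum_eq_zero
      intro x hx
      rw [Finset.HasAntidiagonal.mem_antidiagonal] at hx
      rw [T_C]
      split_ifs with h2
      · rw [T_C, if_neg (by omega)]
      · simp
  | hadd f g hf hg => intro k; simp only [map_add, hf, hg, Finset.sum_add_distrib]
  | hX n f hf =>
    intro k
    simp only [T_X_mul, map_add, map_smul, Finset.sum_add_distrib, ← Finset.smul_sum,
      ← Finset.mul_sum, hf]
    rw [add_smul, add_assoc]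
    congr 2
    · have := sum_antidiag_shift (fun i j => T a i (T b j f)) k (n + 1)
      rw [show (∑ x ∈ Finset.HasAntidiagonal.antidiagonal k, Ts a x.1 (n + 1) (T b x.2 f)) =
        ∑ x ∈ Finset.HasAntidiagonal.antidiagonal k, if n + 1 ≤ x.1 then T a (x.1 - (n + 1)) (T b x.2 f) else 0 from
        Finset.sum_congr rfl fun x _ => by unfold Ts; split_ifs <;> rfl, this, Ts]
      split_ifs
      · rw [hf]
      · rfl
    · have := sum_antidiag_shift' (fun i j => T a i (T b j f)) k (n + 1)
      rw [show (∑ x ∈ Finset.HasAntidiagonal.antidiagonal k, T a x.1 (Ts b x.2 (n + 1) f)) =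
        ∑ x ∈ Finset.HasAntidiagonal.antidiagonal k, if n + 1 ≤ x.2 then T a x.1 (T b (x.2 - (n + 1)) f) else 0 from
        Finset.sum_congr rfl fun x _ => by unfold Ts; split_ifs <;> simp, this, Ts]
      split_ifs
      · rw [hf]
      · rfl

theorem T_scale (c : F) (b : ℕ → F) (f : Sym F) : ∀ k, T (fun n => c ^ (n + 1) * b n) k f =
    c ^ k • T b k f := by
  induction f using sym_induction with
  | hC c =>
    intro k
    rw [T_C, T_C]
    split_ifs with h
    · subst h; simp
    · simp
  | hadd f g hf hg => intro k; simp only [map_add, hf, hg, smul_add]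
  | hX n f hf =>
    intro k
    simp only [T_X_mul, hf, smul_add, Ts, mul_smul_comm]
    congr 1
    split_ifs with h
    · rw [hf, smul_smul, smul_smul]
      congr 1
      obtain ⟨m, rfl⟩ := Nat.exists_eq_add_of_le h
      rw [Nat.add_sub_cancel_left, pow_add c (n + 1) m]
      ring
    · simp

theorem T_mul (b : ℕ → F) (f g : Sym F) (k : ℕ) :
    T b k (f * g) = ∑ x ∈ Finset.HasAntidiagonal.antidiagonal k, T b x.1 f * T b x.2 g := by
  rw [T_def, map_mul, Polynomial.coeff_mul]; rfl

theorem T_eventually (b : ℕ → F) (f : Sym F) : ∃ N, ∀ k, N < k → T b k f = 0 :=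
  ⟨(tau b f).natDegree, fun _ hk => Polynomial.coeff_eq_zero_of_natDegree_lt hk⟩

theorem ip_C_left (w : ℕ → F) (c : F) (g : Sym F) : ip w (MvPolynomial.C c) g = c * g.coeff 0 := by
  have : (MvPolynomial.C c : Sym F) = c • 1 := by rw [MvPolynomial.smul_eq_C_mul, mul_one]
  rw [this, map_smul, LinearMap.smul_apply, ip_one_left, smul_eq_mul]

theorem coeff_zero_mul (f g : Sym F) : (f * g).coeff 0 = f.coeff 0 * g.coeff 0 := by
  simp only [← MvPolynomial.constantCoeff_eq, map_mul]

/-- multiplication by `K` is adjoint to a shift. -/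
theorem ip_K_mul (w a : ℕ → F) (f : Sym F) : ∀ (k : ℕ) (g : Sym F),
    ip w f (K a k * g) = ip w (T (fun n => a n * w n / (n + 1)) k f) g := by
  induction f using sym_induction with
  | hC c =>
    intro k g
    rw [T_C, ip_C_left, coeff_zero_mul, coeff_zero_K]
    split_ifs with h
    · rw [ip_C_left]; ring
    · simp
  | hadd f g hf hg => intro k h; simp only [map_add, LinearMap.add_apply, hf, hg]
  | hX n f hf =>
    intro k g
    rw [ip_X_mul, T_X_mul, map_add, LinearMap.add_apply, ip_X_mul, Derivation.leibniz, pderiv_K,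
      map_add, smul_eq_mul, smul_eq_mul, hf, mul_add, map_smul, LinearMap.smul_apply]
    congr 1
    rw [mul_smul_comm, map_smul, Ts, Ks]
    split_ifs with h
    · rw [mul_comm g, hf, smul_eq_mul, smul_eq_mul]; ring
    · simp

/-- Hall weights. -/
def hw (F : Type*) [Field F] : ℕ → F := fun n => (n : F) + 1

theorem hw_ne (n : ℕ) : hw F n ≠ 0 := Nat.cast_add_one_ne_zero _

/-- the Hall inner product. -/
abbrev hall : Sym F →ₗ[F] Sym F →ₗ[F] F := ip (hw F)

theorem hall_K_mul (a : ℕ → F) (f g : Sym F) (k : ℕ) :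
    hall f (K a k * g) = hall (T a k f) g := by
  rw [hall, ip_K_mul]
  have : (fun n => a n * hw F n / ((n : F) + 1)) = a := by
    funext n
    have := hw_ne (F := F) n
    have e : hw F n = (n : F) + 1 := rfl
    rw [← e]
    field_simp
  rw [this]

theorem hall_K (a : ℕ → F) (f : Sym F) (k : ℕ) :
    hall f (K a k) = (T a k f).coeff 0 := by
  have := hall_K_mul a f 1 k
  rw [mul_one] at this
  rw [this, ip_symm, ip_one_left]

theorem hall_ext {f g : Sym F} (h : ∀ x, hall x f = hall x g) : f = g := by
  rw [← sub_eq_zero]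
  apply ip_nondeg (hw F) hw_ne
  intro x
  rw [ip_symm, map_sub, h, sub_self]

theorem K_add (a b : ℕ → F) (k : ℕ) : K (fun n => a n + b n) k =
    ∑ x ∈ Finset.HasAntidiagonal.antidiagonal k, K a x.1 * K b x.2 := by
  apply hall_ext
  intro f
  rw [hall_K, T_add, map_sum, MvPolynomial.coeff_sum]
  refine Finset.sum_congr rfl fun x _ => ?_
  rw [hall_K_mul, hall_K, T_comm]

theorem K_scale (c : F) (a : ℕ → F) (k : ℕ) : K (fun n => c ^ (n + 1) * a n) k = c ^ k • K a k := by
  apply hall_ext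
  intro f
  rw [hall_K, T_scale, map_smul, hall_K, MvPolynomial.coeff_smul]

/-- weighted homogeneity. -/
def Homog (j : ℕ) (f : Sym F) : Prop := ∀ d, f.coeff d ≠ 0 → wt d = j

theorem ip_homog (w : ℕ → F) {i j : ℕ} {f g : Sym F} (hf : Homog i f) (hg : Homog j g)
    (h : i ≠ j) : ip w f g = 0 := by
  rw [ip_apply]
  apply Finset.sum_eq_zero
  intro d _
  by_cases h1 : f.coeff d = 0
  · simp [h1]
  · by_cases h2 : g.coeff d = 0
    · simp [h2]
    · exact absurd ((hf d h1).symm.trans (hg d h2)) h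

theorem Homog_K (a : ℕ → F) (k : ℕ) : Homog k (K a k) := by
  intro d hd
  rw [coeff_K] at hd
  by_contra h
  simp [h] at hd

theorem Homog_mul {i j : ℕ} {f g : Sym F} (hf : Homog i f) (hg : Homog j g) :
    Homog (i + j) (f * g) := by
  classical
  intro d hd
  rw [MvPolynomial.coeff_mul] at hd
  obtain ⟨x, hx, hx'⟩ := Finset.exists_ne_zero_of_sum_ne_zero hd
  rw [Finset.HasAntidiagonal.mem_antidiagonal] at hx
  rw [← hx, wt_add, hf _ (left_ne_zero_of_mul hx'), hg _ (right_ne_zero_of_mul hx')]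

theorem Homog_monomial (d : ℕ →₀ ℕ) (c : F) : Homog (wt d) (MvPolynomial.monomial d c : Sym F) := by
  classical
  intro e he
  rw [MvPolynomial.coeff_monomial] at he
  by_contra h
  apply he
  rw [if_neg]
  rintro rfl
  exact h rfl

theorem Homog_T {j : ℕ} {f : Sym F} (hf : Homog j f) (b : ℕ → F) (k : ℕ) (d : ℕ →₀ ℕ)
    (hd : (T b k f).coeff d ≠ 0) : k + wt d = j := by
  by_contra h
  apply hd
  have h1 := hall_K_mul b f (MvPolynomial.monomial d 1) k
  rw [ip_homog (hw F) hf (Homog_mul (Homog_K b k) (Homog_monomial d 1)) (Ne.symm h),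
    ip_monomial_right] at h1
  simpa [wgt_ne_zero (hw F) hw_ne d] using h1.symm

theorem T_coeff_zero {j : ℕ} {f : Sym F} (hf : Homog j f) (b : ℕ → F) (k : ℕ) (h : k ≠ j) :
    (T b k f).coeff 0 = 0 := by
  by_contra h'
  have := Homog_T hf b k 0 h'
  rw [wt_zero] at this
  omega

/-- the constants `⟨K a, K b⟩`. -/
def kk (a b : ℕ → F) (j : ℕ) : F := hall (K a j) (K b j)

theorem kk_zero (a b : ℕ → F) : kk a b 0 = 1 := by
  unfold kk
  rw [K_zero, K_zero, ip_one_left]; simp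

theorem kk_rec (a b : ℕ → F) (j : ℕ) : (j : F) * kk a b j =
    ∑ n ∈ Finset.range j, a n * b n * kk a b (j - (n + 1)) := by
  unfold kk
  rw [← smul_eq_mul, ← LinearMap.smul_apply, ← map_smul, K_euler, map_sum, LinearMap.sum_apply]
  refine Finset.sum_congr rfl fun n hn => ?_
  rw [Finset.mem_range] at hn
  rw [map_smul, LinearMap.smul_apply, ip_X_mul, pderiv_K, Ks, if_pos (by omega), map_smul]
  have := hw_ne (F := F) n
  have e : hw F n = (n : F) + 1 := rfl
  simp only [smul_eq_mul]
  rw [← e]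
  field_simp

/-- shift of `K`. -/
theorem T_K (a b : ℕ → F) (j k : ℕ) : T b j (K a k) = kk a b j • Ks a k j := by
  apply hall_ext
  intro g
  rw [ip_symm, ← hall_K_mul, ip_symm, hall_K, T_mul, MvPolynomial.coeff_sum]
  have h1 : ∀ x ∈ Finset.HasAntidiagonal.antidiagonal k, (T a x.1 (K b j) * T a x.2 g).coeff 0 =
      if x.1 = j then kk a b j * (T a (k - j) g).coeff 0 else 0 := by
    intro x hx
    rw [Finset.HasAntidiagonal.mem_antidiagonal] at hx
    rw [coeff_zero_mul]
    split_ifs with h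
    · subst h
      rw [← hall_K, ip_symm, kk, show x.2 = k - x.1 by omega]
    · rw [T_coeff_zero (Homog_K b j) a _ h, zero_mul]
  rw [Finset.sum_congr rfl h1, map_smul, Ks]
  split_ifs with h
  · rw [Finset.sum_eq_single (j, k - j)]
    · rw [if_pos rfl, hall_K, smul_eq_mul]
    · intro x hx hne
      rw [Finset.HasAntidiagonal.mem_antidiagonal] at hx
      rw [if_neg]
      intro h2
      apply hne
      ext <;> simp <;> omega
    · intro hx
      simp at hx
      omega
  · rw [map_zero, smul_zero]
    apply Finset.sum_eq_zero
    intro x hx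
    rw [Finset.HasAntidiagonal.mem_antidiagonal] at hx
    rw [if_neg (by omega)]

end ShiftPart

section PartitionPart
set_option linter.unusedSectionVars false
variable [CharZero F]

theorem Partition.ext' {a b : Partition} (h : ∀ j, a.part j = b.part j) : a = b := by
  cases a; cases b
  congr
  ext j
  exact h j

/-- build a partition from an antitone function. -/
def Partition.ofFun (f : ℕ → ℕ) (hf : ∀ ⦃i j : ℕ⦄, i ≤ j → f j ≤ f i) (L : ℕ)
    (hL : ∀ j, L ≤ j → f j = 0) : Partition where
  part := Finsupp.onFinset (Finset.range L) f (fun j h => by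
    by_contra hc
    exact h (hL j (by simpa using hc)))
  antitone' := fun i j h => hf h

theorem Partition.ofFun_part (f : ℕ → ℕ) (hf) (L : ℕ) (hL) (j : ℕ) :
    (Partition.ofFun f hf L hL).part j = f j := rfl

theorem Partition.exists_bound (mu : Partition) : ∃ L, ∀ j, L ≤ j → mu.part j = 0 := by
  refine ⟨mu.part.support.sup id + 1, fun j hj => ?_⟩
  by_contra h
  have : j ≤ mu.part.support.sup id :=
    Finset.le_sup (f := id) (Finsupp.mem_support_iff.2 h)
  omega

/-- remove the first part. -/
def Partition.tail (mu : Partition) : Partition :=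
  Partition.ofFun (fun j => mu.part (j + 1)) (fun _ _ h => mu.antitone' (by omega))
    (Classical.choose mu.exists_bound)
    (fun j hj => Classical.choose_spec mu.exists_bound (j + 1) (by omega))

theorem Partition.tail_part (mu : Partition) (j : ℕ) : mu.tail.part j = mu.part (j + 1) := rfl

/-- prepend a first part. -/
def Partition.cons (m : ℕ) (mu : Partition) (h : mu.part 0 ≤ m) : Partition :=
  Partition.ofFun (fun j => match j with | 0 => m | j + 1 => mu.part j)
    (by
      intro i j hij
      cases i with
      | zero =>
        cases j with
        | zero => exact le_refl _
        | succ j => exact le_trans (mu.antitone' (Nat.zero_le j)) h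
      | succ i =>
        cases j with
        | zero => omega
        | succ j => exact mu.antitone' (by omega))
    (Classical.choose mu.exists_bound + 1)
    (by
      intro j hj
      cases j with
      | zero => omega
      | succ j => exact Classical.choose_spec mu.exists_bound j (by omega))

theorem Partition.cons_zero (m : ℕ) (mu : Partition) (h) : (Partition.cons m mu h).part 0 = m := rfl
theorem Partition.cons_succ (m : ℕ) (mu : Partition) (h) (j : ℕ) :
    (Partition.cons m mu h).part (j + 1) = mu.part j := rfl
theorem Partition.tail_cons (m : ℕ) (mu : Partition) (h) : (Partition.cons m mu h).tail = mu :=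
  Partition.ext' fun _ => rfl

/-- empty partition. -/
def Partition.nil : Partition := Partition.ofFun (fun _ => 0) (fun _ _ _ => le_refl _) 0 (fun _ _ => rfl)

theorem Partition.nil_part (j : ℕ) : Partition.nil.part j = 0 := rfl

theorem prod_support_eq {M : Type*} [CommMonoid M] (mu : Partition) (L : ℕ)
    (hL : ∀ j, L ≤ j → mu.part j = 0) (g : ℕ → ℕ → M) (hg : ∀ j, g j 0 = 1) :
    ∏ j ∈ mu.part.support, g j (mu.part j) = ∏ j ∈ Finset.range L, g j (mu.part j) := by
  apply Finset.prod_subset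
  · intro j hj
    rw [Finset.mem_range]
    by_contra h
    exact Finsupp.mem_support_iff.1 hj (hL j (by omega))
  · intro j _ hj
    rw [Finsupp.notMem_support_iff] at hj
    rw [hj, hg]

theorem sum_support_eq {M : Type*} [AddCommMonoid M] (mu : Partition) (L : ℕ)
    (hL : ∀ j, L ≤ j → mu.part j = 0) (g : ℕ → ℕ → M) (hg : ∀ j, g j 0 = 0) :
    ∑ j ∈ mu.part.support, g j (mu.part j) = ∑ j ∈ Finset.range L, g j (mu.part j) := by
  apply Finset.sum_subset
  · intro j hj
    rw [Finset.mem_range]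
    by_contra h
    exact Finsupp.mem_support_iff.1 hj (hL j (by omega))
  · intro j _ hj
    rw [Finsupp.notMem_support_iff] at hj
    rw [hj, hg]

/-- multiplicity vector. -/
def phi (k : Partition) : ℕ →₀ ℕ := ∑ j ∈ k.part.support, Finsupp.single (k.part j - 1) 1

theorem phi_apply (k : Partition) (n : ℕ) : phi k n = k.mult (n + 1) := by
  unfold phi Partition.mult
  rw [Finsupp.finsetSum_apply, Finset.card_filter]
  refine Finset.sum_congr rfl fun j hj => ?_
  have : k.part j ≠ 0 := Finsupp.mem_support_iff.1 hj
  rw [Finsupp.single_apply]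
  congr 1
  apply propext
  omega

theorem wt_sum {ι : Type*} (s : Finset ι) (g : ι → ℕ →₀ ℕ) : wt (∑ i ∈ s, g i) = ∑ i ∈ s, wt (g i) := by
  classical
  induction s using Finset.induction_on with
  | empty => simp [wt_zero]
  | insert a s ha ih => rw [Finset.sum_insert ha, Finset.sum_insert ha, wt_add, ih]

theorem wt_phi (k : Partition) : wt (phi k) = k.size := by
  unfold phi Partition.size Finsupp.sum
  rw [wt_sum]
  refine Finset.sum_congr rfl fun j hj => ?_
  have : k.part j ≠ 0 := Finsupp.mem_support_iff.1 hj
  rw [wt_single]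
  change (k.part j - 1 + 1) * 1 = k.part j
  omega

theorem pprod_eq (k : Partition) : (pprod k : Sym F) = MvPolynomial.monomial (phi k) 1 := by
  unfold pprod phi
  rw [MvPolynomial.monomial_sum_one]
  rfl

theorem zee_eq (k : Partition) : ((k.zee : F))⁻¹ = kc (fun _ => 1) (phi k) := by
  unfold Partition.zee kc
  have h0 : ∏ r ∈ Finset.Icc 1 (k.part 0), (r ^ k.mult r * Nat.factorial (k.mult r)) =
      ∏ n ∈ Finset.range (k.part 0), ((n + 1) ^ phi k n * Nat.factorial (phi k n)) := by
    have := Finset.prod_Ico_add' (fun r => r ^ k.mult r * Nat.factorial (k.mult r)) 0 (k.part 0) 1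
    rw [Finset.range_eq_Ico]
    simp only [phi_apply]
    rw [this]
    rfl
  rw [h0, Finsupp.prod_of_support_subset (s := Finset.range (k.part 0))]
  · push_cast
    rw [← Finset.prod_inv_distrib]
    refine Finset.prod_congr rfl fun n _ => ?_
    simp
  · intro n hn
    rw [Finsupp.mem_support_iff, phi_apply, Partition.mult] at hn
    obtain ⟨j, hj⟩ := Finset.card_ne_zero.1 hn
    rw [Finset.mem_filter] at hj
    have := k.antitone' (Nat.zero_le j)
    rw [Finset.mem_range]
    omega
  · intro n _
    simp

theorem card_gt (k : Partition) (i B : ℕ) (hB : k.part 0 ≤ B) :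
    (k.part.support.filter fun j => i < k.part j).card = ∑ n ∈ Finset.Ico i B, phi k n := by
  rw [Finset.card_eq_sum_card_fiberwise (f := fun j => k.part j - 1) (t := Finset.Ico i B)]
  · refine Finset.sum_congr rfl fun n hn => ?_
    rw [phi_apply, Partition.mult, Finset.filter_filter]
    congr 1
    ext j
    simp only [Finset.mem_filter, Finset.mem_Ico] at *
    constructor
    · rintro ⟨h1, h2, h3⟩; exact ⟨h1, by omega⟩
    · rintro ⟨h1, h2⟩; exact ⟨h1, by omega, by omega⟩
  · intro j hj
    have hj := Finset.mem_filter.1 (Finset.mem_coe.1 hj)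
    have := k.antitone' (Nat.zero_le j)
    rw [Finset.mem_coe, Finset.mem_Ico]
    beta_reduce
    omega

theorem lt_part_iff (k : Partition) (i j B : ℕ) (hB : k.part 0 ≤ B) :
    i < k.part j ↔ j < ∑ n ∈ Finset.Ico i B, phi k n := by
  rw [← card_gt k i B hB]
  set S := k.part.support.filter fun j => i < k.part j with hS
  have hmem : ∀ x, x ∈ S ↔ i < k.part x := by
    intro x
    rw [hS, Finset.mem_filter, Finsupp.mem_support_iff]
    constructor
    · exact fun h => h.2
    · exact fun h => ⟨by omega, h⟩
  constructor
  · intro h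
    have : Finset.range (j + 1) ⊆ S := by
      intro x hx
      rw [Finset.mem_range] at hx
      rw [hmem]
      exact lt_of_lt_of_le h (k.antitone' (by omega))
    have := Finset.card_le_card this
    rw [Finset.card_range] at this
    omega
  · intro h
    by_contra hc
    have : S ⊆ Finset.range j := by
      intro x hx
      rw [hmem] at hx
      rw [Finset.mem_range]
      by_contra hx'
      have := k.antitone' (show j ≤ x by omega)
      omega
    have := Finset.card_le_card this
    rw [Finset.card_range] at this
    omega

theorem phi_injective : Function.Injective phi := by
  intro k l h
  apply Partition.ext'
  intro j
  have h1 := fun i => lt_part_iff k i j (max (k.part 0) (l.part 0)) (le_max_left _ _)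
  have h2 := fun i => lt_part_iff l i j (max (k.part 0) (l.part 0)) (le_max_right _ _)
  rw [h] at h1
  have h3 : ∀ i, i < k.part j ↔ i < l.part j := fun i => (h1 i).trans (h2 i).symm
  exact le_antisymm (by by_contra hc; exact lt_irrefl _ ((h3 (l.part j)).1 (by omega)))
    (by by_contra hc; exact lt_irrefl _ ((h3 (k.part j)).2 (by omega)))

theorem phi_surjective : Function.Surjective phi := by
  intro d
  obtain ⟨B, hB⟩ : ∃ B, ∀ n, B ≤ n → d n = 0 := by
    refine ⟨d.support.sup id + 1, fun j hj => ?_⟩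
    by_contra h
    have : j ≤ d.support.sup id := Finset.le_sup (f := id) (Finsupp.mem_support_iff.2 h)
    omega
  let c : ℕ → ℕ := fun i => ∑ n ∈ Finset.Ico i B, d n
  have hc : ∀ i j, i ≤ j → c j ≤ c i := fun i j h =>
    Finset.sum_le_sum_of_subset (Finset.Ico_subset_Ico_left h)
  have hcB : c B = 0 := by simp [c]
  let p : ℕ → ℕ := fun j => ((Finset.range B).filter fun i => j < c i).card
  have hp : ∀ i j, i < p j ↔ j < c i := by
    intro i j
    constructor
    · intro h
      by_contra hcon
      have : ((Finset.range B).filter fun i => j < c i) ⊆ Finset.range i := by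
        intro x hx
        rw [Finset.mem_filter] at hx
        rw [Finset.mem_range]
        by_contra hx'
        have := hc i x (by omega)
        omega
      have := Finset.card_le_card this
      rw [Finset.card_range] at this
      exact absurd (lt_of_lt_of_le h this) (lt_irrefl _)
    · intro h
      have : Finset.range (i + 1) ⊆ ((Finset.range B).filter fun i => j < c i) := by
        intro x hx
        rw [Finset.mem_range] at hx
        rw [Finset.mem_filter, Finset.mem_range]
        have := hc x i (by omega)
        refine ⟨?_, by omega⟩
        by_contra hx'
        have := hc B x (by omega)
        have := hc B i
        have : c x ≤ c B := hc _ _ (by omega)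
        omega
      have := Finset.card_le_card this
      rw [Finset.card_range] at this
      exact this
  let k : Partition := Partition.ofFun p
    (by
      intro i j hij
      by_contra hcon
      have h1 := (hp (p i) j).1 (by omega)
      have h2 := (hp (p i) i).2 (by omega)
      omega) (c 0)
    (by
      intro j hj
      by_contra hcon
      have := (hp 0 j).1 (by omega)
      omega)
  refine ⟨k, ?_⟩
  ext n
  rw [phi_apply, Partition.mult]
  have : (k.part.support.filter fun j => k.part j = n + 1) = Finset.Ico (c (n + 1)) (c n) := by
    ext j
    rw [Finset.mem_filter, Finsupp.mem_support_iff, Finset.mem_Ico]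
    have e : k.part j = p j := rfl
    rw [e]
    have h1 := hp n j
    have h2 := hp (n + 1) j
    omega
  rw [this, Nat.card_Ico]
  by_cases hn : n < B
  · have : c n = d n + c (n + 1) := Finset.sum_eq_sum_Ico_succ_bot hn _
    omega
  · have : c n = 0 := by
      have := hc B n (by omega)
      omega
    rw [this, hB n (by omega)]
    simp

theorem hsym_eq (r : ℕ) : hsym F r = K (fun _ => (1 : F)) r := by
  unfold hsym K
  rw [← finsum_mem_eq_finite_toFinset_sum]
  change (∑ᶠ k ∈ {k : Partition | k.size = r}, ((k.zee : F))⁻¹ • (pprod k : Sym F)) = _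
  apply finsum_mem_eq_of_bijOn phi
  · refine ⟨fun k hk => ?_, phi_injective.injOn, fun d hd => ?_⟩
    · change wt (phi k) = r
      rw [wt_phi]; exact hk
    · obtain ⟨k, rfl⟩ := phi_surjective d
      exact ⟨k, by change k.size = r; rw [← wt_phi]; exact hd, rfl⟩
  · intro k _
    rw [zee_eq, pprod_eq, MvPolynomial.smul_monomial]
    simp

end PartitionPart

section LexPart
set_option linter.unusedSectionVars false
variable [CharZero F]

/-- the shift by one variable. -/
abbrev S1 (m : ℕ) : Sym F →ₗ[F] Sym F := T (fun _ => (1 : F)) m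

theorem hall_hsym_mul (f g : Sym F) (m : ℕ) : hall f (hsym F m * g) = hall (S1 m f) g := by
  rw [hsym_eq, hall_K_mul]

theorem hsym_zero : hsym F 0 = 1 := by rw [hsym_eq, K_zero]

/-- monomial coefficients. -/
def cc (mu : Partition) (f : Sym F) : F := hall f (hprod F mu)

theorem hprod_range (mu : Partition) (L : ℕ) (hL : ∀ j, L ≤ j → mu.part j = 0) :
    hprod F mu = ∏ j ∈ Finset.range L, hsym F (mu.part j) :=
  prod_support_eq mu L hL (fun _ m => hsym F m) (fun _ => hsym_zero)

theorem hprod_tail (mu : Partition) : hprod F mu = hsym F (mu.part 0) * hprod F mu.tail := by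
  obtain ⟨L, hL⟩ := mu.exists_bound
  rw [hprod_range mu (L + 1) (fun j hj => hL j (by omega)),
    hprod_range mu.tail L (fun j hj => hL (j + 1) (by omega)), Finset.prod_range_succ', mul_comm]
  rfl

theorem cc_tail (mu : Partition) (f : Sym F) : cc mu f = cc mu.tail (S1 (mu.part 0) f) := by
  unfold cc
  rw [hprod_tail, hall_hsym_mul]

theorem cc_cons (m : ℕ) (mu : Partition) (h : mu.part 0 ≤ m) (f : Sym F) :
    cc (Partition.cons m mu h) f = cc mu (S1 m f) := by
  rw [cc_tail, Partition.tail_cons]; rfl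

theorem hprod_nil : hprod F Partition.nil = 1 := by
  rw [hprod_range _ 0 (fun _ _ => rfl)]; simp

theorem cc_nil (f : Sym F) : cc Partition.nil f = f.coeff 0 := by
  unfold cc
  rw [hprod_nil, ip_symm, ip_one_left]

theorem hall_X_mul_zero (f : Sym F) (h : ∀ m, 1 ≤ m → S1 m f = 0) (n : ℕ) :
    ∀ g, hall f (MvPolynomial.X n * g) = 0 := by
  induction n using Nat.strong_induction_on with
  | _ n ih =>
  intro g
  have h1 := K_euler (fun _ => (1 : F)) (n + 1)
  rw [Finset.sum_range_succ, Nat.sub_self, K_zero, mul_one] at h1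
  have h2 := congrArg (fun x => hall f (x * g)) h1
  simp only [add_mul, Finset.sum_mul, map_add, map_sum, one_smul, mul_assoc, smul_mul_assoc,
    map_smul] at h2
  rw [hall_K_mul, h (n + 1) (by omega), map_zero, Finset.sum_eq_zero] at h2
  · simpa using h2.symm
  · intro j hj
    rw [Finset.mem_range] at hj
    exact ih j hj _

theorem const_of_shift (f : Sym F) (h : ∀ m, 1 ≤ m → S1 m f = 0) :
    f = MvPolynomial.C (f.coeff 0) := by
  rw [← sub_eq_zero]
  apply eq_zero_of_pderiv
  · simp
  · intro n
    rw [map_sub, MvPolynomial.pderiv_C, sub_zero]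
    apply ip_nondeg (hw F) hw_ne
    intro g
    have h1 := hall_X_mul_zero f h n g
    rw [ip_symm, ip_X_mul] at h1
    rw [ip_symm]
    exact (mul_eq_zero.1 h1).resolve_left (hw_ne n)

theorem T_wt (b : ℕ → F) (k : ℕ) (f : Sym F) (d : ℕ →₀ ℕ) (hd : (T b k f).coeff d ≠ 0) :
    ∃ e, f.coeff e ≠ 0 ∧ wt e = k + wt d := by
  by_contra hcon
  push Not at hcon
  apply hd
  have h1 := hall_K_mul b f (MvPolynomial.monomial d 1) k
  rw [ip_apply, Finset.sum_eq_zero, ip_monomial_right] at h1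
  · simpa [wgt_ne_zero (hw F) hw_ne d] using h1.symm
  · intro e _
    by_cases h2 : f.coeff e = 0
    · simp [h2]
    · have h3 := hcon e h2
      have h4 : (K b k * MvPolynomial.monomial d 1).coeff e = 0 := by
        by_contra h5
        exact h3 (Homog_mul (Homog_K b k) (Homog_monomial d 1) e h5)
      simp [h4]

theorem exists_wt_bound (f : Sym F) : ∃ D, ∀ d, f.coeff d ≠ 0 → wt d ≤ D :=
  ⟨f.support.sup wt, fun d hd => Finset.le_sup (f := wt) (MvPolynomial.mem_support_iff.2 hd)⟩

theorem exists_max_shift (f : Sym F) (m0 : ℕ) (h : S1 m0 f ≠ 0) :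
    ∃ m, m0 ≤ m ∧ S1 m f ≠ 0 ∧ ∀ m', m < m' → S1 m' f = 0 := by
  classical
  obtain ⟨N, hN⟩ := T_eventually (fun _ => (1 : F)) f
  have hle : ∀ m, S1 m f ≠ 0 → m ≤ N := fun m hm => by
    by_contra hc
    exact hm (hN m (by omega))
  refine ⟨Nat.findGreatest (fun m => S1 m f ≠ 0) N, Nat.le_findGreatest (hle _ h) h,
    Nat.findGreatest_spec (P := fun m => S1 m f ≠ 0) (hle _ h) h, fun m' hm' => ?_⟩
  by_contra hc
  exact Nat.findGreatest_is_greatest hm' (hle _ hc) hc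

theorem lead_aux (D : ℕ) : ∀ f : Sym F, (∀ d, f.coeff d ≠ 0 → wt d ≤ D) → f ≠ 0 →
    ∃ mu, cc mu f ≠ 0 ∧ ∀ N, (∀ m, N < m → S1 m f = 0) → mu.part 0 ≤ N := by
  induction D using Nat.strong_induction_on with
  | _ D ih =>
  intro f hD hf
  by_cases h : ∀ m, 1 ≤ m → S1 m f = 0
  · refine ⟨Partition.nil, ?_, fun N _ => Nat.zero_le _⟩
    rw [cc_nil]
    intro h0
    apply hf
    rw [const_of_shift f h, h0, MvPolynomial.C_0]
  · push Not at h
    obtain ⟨m0, hm0, hne⟩ := h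
    obtain ⟨m, hm, hmne, hmax⟩ := exists_max_shift f m0 hne
    have hb : ∀ d, (S1 m f).coeff d ≠ 0 → wt d ≤ D - m ∧ m ≤ D := by
      intro d hd
      obtain ⟨e, he, he'⟩ := T_wt _ _ _ _ hd
      have := hD e he
      omega
    have hmD : m ≤ D := by
      obtain ⟨d, hd⟩ := MvPolynomial.ne_zero_iff.1 hmne
      exact (hb d hd).2
    obtain ⟨mu, hmu, hmu'⟩ := ih (D - m) (by omega) (S1 m f) (fun d hd => (hb d hd).1) hmne
    have h0 : mu.part 0 ≤ m := hmu' m (fun m' hm' => by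
      rw [T_comm, hmax m' hm', map_zero])
    refine ⟨Partition.cons m mu h0, ?_, fun N hN => ?_⟩
    · rw [cc_cons]; exact hmu
    · rw [Partition.cons_zero]
      by_contra hc
      exact hmne (hN m (by omega))

theorem lead (f : Sym F) (hf : f ≠ 0) :
    ∃ mu, cc mu f ≠ 0 ∧ ∀ N, (∀ m, N < m → S1 m f = 0) → mu.part 0 ≤ N := by
  obtain ⟨D, hD⟩ := exists_wt_bound f
  exact lead_aux D f hD hf

theorem cc_nondeg (f : Sym F) (h : ∀ mu, cc mu f = 0) : f = 0 := by
  by_contra hf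
  obtain ⟨mu, hmu, _⟩ := lead f hf
  exact hmu (h mu)

/-- the lexicographic key. -/
def key (mu : Partition) : Lex (ℕ → ℕ) := toLex (fun j => mu.part j)

theorem key_injective : Function.Injective key := by
  intro a b h
  apply Partition.ext'
  intro j
  exact congrFun (toLex.injective h) j

theorem key_lt_iff (a b : Partition) :
    key a < key b ↔ ∃ i, (∀ j, j < i → a.part j = b.part j) ∧ a.part i < b.part i := Iff.rfl

theorem key_lt_of_head {a b : Partition} (h : a.part 0 < b.part 0) : key a < key b :=
  (key_lt_iff a b).2 ⟨0, fun j hj => by omega, h⟩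

theorem key_lt_of_tail {a b : Partition} (h : a.part 0 = b.part 0) (h' : key a.tail < key b.tail) :
    key a < key b := by
  obtain ⟨i, h1, h2⟩ := (key_lt_iff _ _).1 h'
  refine (key_lt_iff a b).2 ⟨i + 1, fun j hj => ?_, h2⟩
  cases j with
  | zero => exact h
  | succ j => exact h1 j (by omega)

theorem key_le_of_dominates {lam nu : Partition} (h : Partition.Dominates lam nu) :
    key nu ≤ key lam := by
  by_contra hc
  rw [not_le] at hc
  obtain ⟨i, h1, h2⟩ := (key_lt_iff _ _).1 hc
  have h3 := h.2 (i + 1)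
  unfold Partition.psum at h3
  have e : ∑ j ∈ Finset.range i, lam.part j = ∑ j ∈ Finset.range i, nu.part j :=
    Finset.sum_congr rfl (fun j hj => h1 j (Finset.mem_range.1 hj))
  rw [Finset.sum_range_succ, Finset.sum_range_succ, e] at h3
  omega

/-- all monomial coefficients above `mu` vanish. -/
def HH (f : Sym F) (mu : Partition) : Prop := ∀ nu, key mu < key nu → cc nu f = 0

theorem HH_top {f : Sym F} {mu : Partition} (h : HH f mu) (N : ℕ) (hN : mu.part 0 < N) :
    S1 N f = 0 := by
  by_contra hc
  obtain ⟨m, hm, hmne, hmax⟩ := exists_max_shift f N hc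
  obtain ⟨nu, hnu, hnu'⟩ := lead _ hmne
  have h0 : nu.part 0 ≤ m := hnu' m (fun m' hm' => by rw [T_comm, hmax m' hm', map_zero])
  apply hnu
  rw [← cc_cons m nu h0]
  apply h
  apply key_lt_of_head
  rw [Partition.cons_zero]
  omega

theorem HH_tail {f : Sym F} {mu : Partition} (h : HH f mu) : HH (S1 (mu.part 0) f) mu.tail := by
  intro nu hnu
  by_cases h0 : nu.part 0 ≤ mu.part 0
  · rw [← cc_cons _ nu h0]
    apply h
    apply key_lt_of_tail
    · rw [Partition.cons_zero]
    · rwa [Partition.tail_cons]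
  · rw [cc_tail, T_comm, HH_top h _ (by omega)]
    simp [cc]

theorem cc_add (mu : Partition) (f g : Sym F) : cc mu (f + g) = cc mu f + cc mu g := by
  simp [cc]
theorem cc_smul (mu : Partition) (c : F) (f : Sym F) : cc mu (c • f) = c * cc mu f := by
  simp [cc]
theorem cc_sub (mu : Partition) (f g : Sym F) : cc mu (f - g) = cc mu f - cc mu g := by
  simp [cc]
theorem cc_zero (mu : Partition) : cc mu (0 : Sym F) = 0 := by
  simp [cc]

theorem eq_nil_of_bound (mu : Partition) (h : ∀ j, 0 ≤ j → mu.part j = 0) : mu = Partition.nil :=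
  Partition.ext' fun j => h j (Nat.zero_le j)

end LexPart

section EtaPart
set_option linter.unusedSectionVars false
variable [CharZero F]

/-- `1 - t^{-n}`. -/
def hh (t : F) : ℕ → F := fun n => 1 - t⁻¹ ^ (n + 1)
/-- `q^n - 1`. -/
def ss (q : F) : ℕ → F := fun n => q ^ (n + 1) - 1

/-- Macdonald's operator. -/
def eta (q t : F) : Sym F →ₗ[F] Sym F :=
  (Polynomial.lsum (R := F) (fun k => LinearMap.mulLeft F (K (hh t) k))) ∘ₗ (tau (ss q)).toLinearMap

theorem eta_eq (q t : F) (f : Sym F) (N : ℕ) (hN : ∀ k, N ≤ k → T (ss q) k f = 0) :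
    eta q t f = ∑ k ∈ Finset.range N, K (hh t) k * T (ss q) k f := by
  unfold eta
  rw [LinearMap.comp_apply, Polynomial.lsum_apply, Polynomial.sum_def]
  apply Finset.sum_subset
  · intro k hk
    rw [Finset.mem_range]
    by_contra hc
    exact Polynomial.mem_support_iff.1 hk (hN k (by omega))
  · intro k _ hk
    rw [Polynomial.notMem_support_iff] at hk
    rw [hk]; simp

theorem T_bound (b : ℕ → F) (f : Sym F) : ∃ N, ∀ k, N ≤ k → T b k f = 0 := by
  obtain ⟨N, hN⟩ := T_eventually b f
  exact ⟨N + 1, fun k hk => hN k (by omega)⟩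

theorem eta_C (q t c : F) : eta q t (MvPolynomial.C c) = MvPolynomial.C c := by
  rw [eta_eq q t _ 1 (fun k hk => by rw [T_C, if_neg (by omega)])]
  simp [K_zero, T_C]

/-- the weights of the `(q,t)` form. -/
def wqt (q t : F) : ℕ → F := fun n => ((n : F) + 1) * ((1 - q ^ (n + 1)) / (1 - t ^ (n + 1)))

/-- the `(q,t)` form as a bilinear map. -/
abbrev bq (q t : F) : Sym F →ₗ[F] Sym F →ₗ[F] F := ip (wqt q t)

/-- nondegeneracy assumptions. -/
structure Gen (q t : F) : Prop where
  q0 : q ≠ 0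
  t0 : t ≠ 0
  q1 : ∀ n, 1 - q ^ (n + 1) ≠ 0
  t1 : ∀ n, 1 - t ^ (n + 1) ≠ 0

theorem wqt_ne {q t : F} (h : Gen q t) (n : ℕ) : wqt q t n ≠ 0 :=
  mul_ne_zero (Nat.cast_add_one_ne_zero _) (div_ne_zero (h.q1 n) (h.t1 n))

theorem wqt_div (q t : F) (n : ℕ) : wqt q t n / ((n : F) + 1) = (1 - q ^ (n + 1)) / (1 - t ^ (n + 1)) := by
  have : (n : F) + 1 ≠ 0 := Nat.cast_add_one_ne_zero _
  unfold wqt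
  field_simp

theorem bq_K_mul {q t : F} (h : Gen q t) (k : ℕ) (f g : Sym F) :
    bq q t f (K (hh t) k * g) = t⁻¹ ^ k * bq q t (T (ss q) k f) g := by
  have e : (fun n => hh t n * wqt q t n / ((n : F) + 1)) = fun n => t⁻¹ ^ (n + 1) * ss q n := by
    funext n
    rw [mul_div_assoc, wqt_div]
    unfold hh ss
    have := h.t1 n
    have := pow_ne_zero (n + 1) h.t0
    rw [inv_pow]
    field_simp
    ring
  rw [bq, ip_K_mul, e, T_scale, map_smul, LinearMap.smul_apply, smul_eq_mul]

theorem eta_symm {q t : F} (h : Gen q t) (f g : Sym F) :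
    bq q t (eta q t f) g = bq q t f (eta q t g) := by
  obtain ⟨N, hN⟩ := T_bound (ss q) f
  obtain ⟨M, hM⟩ := T_bound (ss q) g
  rw [eta_eq q t f (max N M) (fun k hk => hN k (le_trans (le_max_left _ _) hk)),
    eta_eq q t g (max N M) (fun k hk => hM k (le_trans (le_max_right _ _) hk)),
    map_sum, map_sum, LinearMap.sum_apply]
  refine Finset.sum_congr rfl fun k _ => ?_
  rw [bq_K_mul h, bq, ip_symm, ← bq, bq_K_mul h, bq, ip_symm]

theorem kk_unique (a b c : ℕ → F) (h0 : c 0 = 1) (hc : ∀ j, ((j + 1 : ℕ) : F) * c (j + 1) =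
    ∑ n ∈ Finset.range (j + 1), a n * b n * c (j - n)) (j : ℕ) : kk a b j = c j := by
  induction j using Nat.strong_induction_on with
  | _ j ih =>
  cases j with
  | zero => rw [kk_zero, h0]
  | succ j =>
    have h1 := kk_rec a b (j + 1)
    have h2 := hc j
    have h3 : ∑ n ∈ Finset.range (j + 1), a n * b n * kk a b (j + 1 - (n + 1)) =
        ∑ n ∈ Finset.range (j + 1), a n * b n * c (j - n) := by
      refine Finset.sum_congr rfl fun n _ => ?_
      rw [ih _ (by omega), Nat.add_sub_add_right]
    rw [h3, ← h2] at h1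
    exact mul_left_cancel₀ (Nat.cast_ne_zero.2 (Nat.succ_ne_zero j)) h1

theorem kk_theta (t : F) (j : ℕ) :
    kk (hh t) (fun _ => 1) j = if j = 0 then 1 else 1 - t⁻¹ := by
  apply kk_unique _ _ (fun j => if j = 0 then 1 else 1 - t⁻¹)
  · simp
  · intro j
    rw [Finset.sum_range_succ, if_neg (Nat.succ_ne_zero j), Nat.sub_self, if_pos rfl]
    have h1 : ∑ x ∈ Finset.range j, hh t x * 1 * (if j - x = 0 then 1 else 1 - t⁻¹) =
        (j : F) * (1 - t⁻¹) - t⁻¹ * (1 - t⁻¹ ^ j) := by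
      have h2 : ∀ x ∈ Finset.range j, hh t x * 1 * (if j - x = 0 then 1 else 1 - t⁻¹) =
          (1 - t⁻¹) - t⁻¹ * ((1 - t⁻¹) * t⁻¹ ^ x) := by
        intro x hx
        rw [Finset.mem_range] at hx
        rw [if_neg (by omega), hh, pow_succ]
        ring
      rw [Finset.sum_congr rfl h2, Finset.sum_sub_distrib, ← Finset.mul_sum, ← Finset.mul_sum,
        mul_neg_geom_sum, Finset.sum_const, Finset.card_range, nsmul_eq_mul]
    rw [h1, hh, pow_succ]
    push_cast
    ring

theorem sum_range_shift {M : Type*} [AddCommMonoid M] (g : ℕ → ℕ → M) (B j : ℕ)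
    (hg : ∀ i k, B ≤ k → g i k = 0) :
    (∑ k ∈ Finset.range B, if j ≤ k then g (k - j) k else 0) =
      ∑ k ∈ Finset.range B, g k (k + j) := by
  have h1 : (∑ k ∈ Finset.range B, if j ≤ k then g (k - j) k else 0) =
      ∑ k ∈ Finset.range (j + B), if j ≤ k then g (k - j) k else 0 := by
    apply Finset.sum_subset (Finset.range_mono (by omega))
    intro k _ hk
    rw [Finset.mem_range] at hk
    split_ifs
    · exact hg _ _ (by omega)
    · rfl
  rw [h1, Finset.sum_range_add, Finset.sum_eq_zero, zero_add]
  · refine Finset.sum_congr rfl fun k _ => ?_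
    rw [if_pos (by omega), Nat.add_sub_cancel_left, add_comm]
  · intro k hk
    rw [Finset.mem_range] at hk
    rw [if_neg (by omega)]

theorem T_q (q : F) (f : Sym F) (k : ℕ) :
    ∑ x ∈ Finset.HasAntidiagonal.antidiagonal k, T (ss q) x.1 (S1 x.2 f) = q ^ k • S1 k f := by
  rw [← T_add]
  have e : (fun n => ss q n + 1) = fun n => q ^ (n + 1) * 1 := by
    funext n; unfold ss; ring
  rw [e, T_scale]

theorem T_q_top (q : F) (f : Sym F) (N M k : ℕ) (hM : N ≤ M) (hN : ∀ m, N < m → S1 m f = 0) :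
    ∑ x ∈ Finset.HasAntidiagonal.antidiagonal M, T (ss q) (k + x.1) (S1 x.2 f) =
      q ^ (k + M) • S1 (k + M) f := by
  rw [← T_q]
  have h1 := sum_antidiag_shift (fun i j => T (ss q) (k + i) (S1 j f)) (k + M) k
  rw [if_pos (by omega), Nat.add_sub_cancel_left] at h1
  rw [← h1]
  refine Finset.sum_congr rfl fun x hx => ?_
  rw [Finset.HasAntidiagonal.mem_antidiagonal] at hx
  split_ifs with h
  · congr 2; omega
  · rw [hN x.2 (by omega), map_zero]

theorem eta_top (q t : F) (f : Sym F) (N M : ℕ) (hM : N ≤ M) (hN : ∀ m, N < m → S1 m f = 0) :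
    S1 M (eta q t f) = t⁻¹ • eta q t (S1 M f) + ((1 - t⁻¹) * q ^ M) • S1 M f := by
  obtain ⟨B, hB⟩ := T_bound (ss q) f
  have hB' : ∀ k, B + 1 ≤ k → T (ss q) k f = 0 := fun k hk => hB k (by omega)
  have hBS : ∀ i k, B + 1 ≤ k → T (ss q) k (S1 i f) = 0 := fun i k hk => by
    rw [T_comm, hB k (by omega), map_zero]
  rw [eta_eq q t f (B + 1) hB', eta_eq q t (S1 M f) (B + 1) (hBS M), map_sum]
  have h1 : ∀ k ∈ Finset.range (B + 1), S1 M (K (hh t) k * T (ss q) k f) =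
      ∑ x ∈ Finset.HasAntidiagonal.antidiagonal M, (if x.1 ≤ k then
        (fun i k => (if x.1 = 0 then (1 : F) else 1 - t⁻¹) •
          (K (hh t) i * T (ss q) k (S1 x.2 f))) (k - x.1) k else 0) := by
    intro k _
    rw [S1, T_mul]
    refine Finset.sum_congr rfl fun x _ => ?_
    rw [T_K, kk_theta, Ks, T_comm]
    split_ifs <;> simp
  rw [Finset.sum_congr rfl h1, Finset.sum_comm]
  have h2 : ∀ x ∈ Finset.HasAntidiagonal.antidiagonal M, (∑ k ∈ Finset.range (B + 1), (if x.1 ≤ k then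
        (fun i k => (if x.1 = 0 then (1 : F) else 1 - t⁻¹) •
          (K (hh t) i * T (ss q) k (S1 x.2 f))) (k - x.1) k else 0)) =
      (if x = (0, M) then t⁻¹ • ∑ k ∈ Finset.range (B + 1), K (hh t) k * T (ss q) k (S1 M f) else 0)
        + (1 - t⁻¹) • ∑ k ∈ Finset.range (B + 1), K (hh t) k * T (ss q) (k + x.1) (S1 x.2 f) := by
    intro x hx
    rw [Finset.HasAntidiagonal.mem_antidiagonal] at hx
    rw [sum_range_shift (fun i k => (if x.1 = 0 then (1 : F) else 1 - t⁻¹) •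
          (K (hh t) i * T (ss q) k (S1 x.2 f))) (B + 1) x.1
          (fun i k hk => by rw [hBS _ _ hk]; simp), ← Finset.smul_sum]
    by_cases h : x.1 = 0
    · have hx2 : x = (0, M) := by ext <;> simp <;> omega
      subst hx2
      simp only [if_true, add_zero]
      rw [← add_smul]
      congr 1
      ring
    · rw [if_neg h, if_neg (by rintro rfl; exact h rfl), zero_add]
  rw [Finset.sum_congr rfl h2, Finset.sum_add_distrib, Finset.sum_ite_eq',
    if_pos (by simp), ← Finset.smul_sum, Finset.sum_comm]
  congr 1
  rw [mul_smul]
  congr 1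
  simp only [← Finset.mul_sum]
  rw [Finset.sum_eq_single 0]
  · rw [T_q_top q f N M 0 hM hN, K_zero, one_mul, zero_add]
  · intro k _ hk
    rw [T_q_top q f N M k hM hN, hN (k + M) (by omega)]
    simp
  · intro h; simp at h

/-- eigenvalues. -/
def eps (q t : F) (mu : Partition) : F :=
  1 + (1 - t⁻¹) * ∑ j ∈ mu.part.support, t⁻¹ ^ j * (q ^ mu.part j - 1)

theorem eps_range (q t : F) (mu : Partition) (L : ℕ) (hL : ∀ j, L ≤ j → mu.part j = 0) :
    eps q t mu = 1 + (1 - t⁻¹) * ∑ j ∈ Finset.range L, t⁻¹ ^ j * (q ^ mu.part j - 1) := by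
  unfold eps
  rw [sum_support_eq mu L hL (fun j m => t⁻¹ ^ j * (q ^ m - 1)) (by simp)]

theorem eps_nil (q t : F) : eps q t Partition.nil = 1 := by
  rw [eps_range _ _ _ 0 (fun _ _ => rfl)]; simp

theorem eps_tail (q t : F) (mu : Partition) :
    eps q t mu = t⁻¹ * eps q t mu.tail + (1 - t⁻¹) * q ^ mu.part 0 := by
  obtain ⟨L, hL⟩ := mu.exists_bound
  rw [eps_range q t mu (L + 1) (fun j hj => hL j (by omega)),
    eps_range q t mu.tail L (fun j hj => hL (j + 1) (by omega)), Finset.sum_range_succ']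
  have : ∑ k ∈ Finset.range L, t⁻¹ ^ (k + 1) * (q ^ mu.part (k + 1) - 1) =
      t⁻¹ * ∑ k ∈ Finset.range L, t⁻¹ ^ k * (q ^ mu.tail.part k - 1) := by
    rw [Finset.mul_sum]
    refine Finset.sum_congr rfl fun k _ => ?_
    rw [Partition.tail_part, pow_succ]; ring
  rw [this]
  ring

theorem cc_eta_aux (q t : F) (L : ℕ) : ∀ (mu : Partition) (_ : ∀ j, L ≤ j → mu.part j = 0)
    (f : Sym F), HH f mu → cc mu (eta q t f) = eps q t mu * cc mu f := by
  induction L with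
  | zero =>
    intro mu hL f hf
    have := eq_nil_of_bound mu hL
    subst this
    rw [const_of_shift f (fun m hm => HH_top hf m hm), eta_C, eps_nil, one_mul]
  | succ L ih =>
    intro mu hL f hf
    have h1 := ih mu.tail (fun j hj => hL (j + 1) (by omega)) _ (HH_tail hf)
    rw [cc_tail, eta_top q t f (mu.part 0) (mu.part 0) (le_refl _) (fun m hm => HH_top hf m hm),
      cc_add, cc_smul, cc_smul, h1, cc_tail mu f, eps_tail q t mu]
    ring

theorem cc_eta (q t : F) (mu : Partition) (f : Sym F) (hf : HH f mu) :
    cc mu (eta q t f) = eps q t mu * cc mu f := by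
  obtain ⟨L, hL⟩ := mu.exists_bound
  exact cc_eta_aux q t L mu hL f hf

theorem HH_eta (q t : F) (mu : Partition) (f : Sym F) (hf : HH f mu) : HH (eta q t f) mu := by
  intro nu hnu
  rw [cc_eta q t nu f (fun x hx => hf x (hnu.trans hx)), hf nu hnu, mul_zero]

end EtaPart

section BasisPart
set_option linter.unusedSectionVars false
variable [CharZero F]

theorem innerQT_bq (q t : F) (f g : Sym F) : innerQT q t f g = bq q t f g := innerQT_eq q t f g

theorem innerQT_hall {t : F} (ht : ∀ n, 1 - t ^ (n + 1) ≠ 0) (f g : Sym F) :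
    innerQT t t f g = hall f g := by
  rw [innerQT_eq]
  have : (fun n : ℕ => ((n : F) + 1) * ((1 - t ^ (n + 1)) / (1 - t ^ (n + 1)))) = hw F := by
    funext n
    rw [div_self (ht n), mul_one]; rfl
  rw [this]

/-- full genericity package. -/
structure Mac (q t : F) (P : Partition → Sym F) : Prop where
  gen : Gen q t
  inj : Function.Injective (eps q t)
  orth : ∀ lam mu, lam ≠ mu → bq q t (P lam) (P mu) = 0
  diag : ∀ lam, cc lam (P lam) = 1
  tri : ∀ lam mu, ¬ Partition.Dominates lam mu → cc mu (P lam) = 0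

theorem Mac.of {q t : F} {P : Partition → Sym F} (hg : Gen q t) (hi : Function.Injective (eps q t))
    (h : IsMacdonald q t P) : Mac q t P where
  gen := hg
  inj := hi
  orth := fun lam mu hne => by rw [← innerQT_bq]; exact h.1 lam mu hne
  diag := fun lam => by rw [cc, ← innerQT_hall hg.t1]; exact h.2.1 lam
  tri := fun lam mu hd => by rw [cc, ← innerQT_hall hg.t1]; exact h.2.2 lam mu hd

theorem finite_size_le (D : ℕ) : {nu : Partition | nu.size ≤ D}.Finite := by
  apply Set.Finite.of_finite_image ((finite_wt_le D).subset _) (phi_injective.injOn)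
  rintro _ ⟨nu, hnu, rfl⟩
  change wt (phi nu) ≤ D
  rw [wt_phi]; exact hnu

theorem Homog_one : Homog 0 (1 : Sym F) := by
  rw [← K_zero (fun _ => (0 : F))]; exact Homog_K _ _

theorem Homog_prod {ι : Type*} (s : Finset ι) (g : ι → Sym F) (e : ι → ℕ)
    (h : ∀ i ∈ s, Homog (e i) (g i)) : Homog (∑ i ∈ s, e i) (∏ i ∈ s, g i) := by
  classical
  induction s using Finset.induction_on with
  | empty => simpa using Homog_one
  | insert a s ha ih =>
    rw [Finset.sum_insert ha, Finset.prod_insert ha]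
    exact Homog_mul (h a (by simp)) (ih fun i hi => h i (by simp [hi]))

theorem Homog_hprod (mu : Partition) : Homog mu.size (hprod F mu) :=
  Homog_prod _ _ _ (fun i _ => by rw [hsym_eq]; exact Homog_K _ _)

theorem cc_of_wt (f : Sym F) (mu : Partition) (h : cc mu f ≠ 0) :
    ∃ d, f.coeff d ≠ 0 ∧ wt d = mu.size := by
  unfold cc at h
  rw [ip_apply] at h
  obtain ⟨d, hd, hd'⟩ := Finset.exists_ne_zero_of_sum_ne_zero h
  refine ⟨d, MvPolynomial.mem_support_iff.1 hd, ?_⟩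
  exact Homog_hprod mu d (right_ne_zero_of_mul (left_ne_zero_of_mul hd'))

/-- homogeneous component. -/
def comp (j : ℕ) (f : Sym F) : Sym F :=
  ∑ d ∈ f.support with wt d = j, MvPolynomial.monomial d (f.coeff d)

theorem coeff_comp (j : ℕ) (f : Sym F) (d : ℕ →₀ ℕ) :
    (comp j f).coeff d = if wt d = j then f.coeff d else 0 := by
  classical
  unfold comp
  rw [MvPolynomial.coeff_sum]
  simp only [MvPolynomial.coeff_monomial]
  rw [Finset.sum_ite_eq']
  by_cases h1 : wt d = j
  · by_cases h2 : f.coeff d = 0 <;> simp [h1, h2]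
  · simp [h1]

theorem ip_comp (w : ℕ → F) (j : ℕ) (f g : Sym F) (hg : Homog j g) :
    ip w (comp j f) g = ip w f g := by
  rw [ip_symm, ip_symm w f, ip_apply, ip_apply]
  refine Finset.sum_congr rfl fun d hd => ?_
  rw [coeff_comp, if_pos (hg d (MvPolynomial.mem_support_iff.1 hd))]

theorem Homog_comp (j : ℕ) (f : Sym F) : Homog j (comp j f) := by
  intro d hd
  rw [coeff_comp] at hd
  by_contra h
  simp [h] at hd

variable {q t : F} {P : Partition → Sym F}

theorem Mac.hom (h : Mac q t P) (lam : Partition) : Homog lam.size (P lam) := by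
  have key0 : ∀ j, j ≠ lam.size → comp j (P lam) = 0 := by
    intro j hj
    apply cc_nondeg
    intro nu
    by_cases h1 : nu.size = j
    · subst h1
      rw [cc, ip_comp _ _ _ _ (Homog_hprod nu)]
      exact h.tri lam nu (fun hd => hj hd.1)
    · exact ip_homog _ (Homog_comp j _) (Homog_hprod nu) (Ne.symm h1)
  intro d hd
  by_contra hne
  have := congrArg (MvPolynomial.coeff d) (key0 (wt d) hne)
  rw [coeff_comp, if_pos rfl] at this
  exact hd (by simpa using this)

theorem Mac.ne (h : Mac q t P) (lam : Partition) : P lam ≠ 0 := by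
  intro h0
  have := h.diag lam
  rw [h0, cc_zero] at this
  exact zero_ne_one this

theorem Mac.elim (h : Mac q t P) (n : ℕ) : ∀ (A : Finset Partition), A.card = n →
    (∀ nu ∈ A, ∀ nu', Partition.Dominates nu nu' → nu' ∈ A) →
    ∀ f : Sym F, (∀ nu, nu ∉ A → cc nu f = 0) → f ∈ Submodule.span F (P '' (A : Set Partition)) := by
  classical
  induction n with
  | zero =>
    intro A hA _ f hf
    rw [Finset.card_eq_zero] at hA
    subst hA
    rw [cc_nondeg f (fun mu => hf mu (by simp))]
    exact Submodule.zero_mem _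
  | succ n ih =>
    intro A hA hcl f hf
    obtain ⟨m, hm, hmax⟩ := Finset.exists_max_image A key (Finset.card_pos.1 (by omega))
    have h1 := ih (A.erase m) (by rw [Finset.card_erase_of_mem hm]; omega)
      (by
        intro nu hnu nu' hd
        rw [Finset.mem_erase] at hnu ⊢
        refine ⟨?_, hcl nu hnu.2 nu' hd⟩
        rintro rfl
        exact hnu.1 (key_injective (le_antisymm (hmax nu hnu.2) (key_le_of_dominates hd))))
      (f - cc m f • P m)
      (by
        intro nu hnu
        rw [cc_sub, cc_smul]
        by_cases he : nu = m
        · subst he; rw [h.diag, mul_one, sub_self]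
        · have hnA : nu ∉ A := fun hA => hnu (Finset.mem_erase.2 ⟨he, hA⟩)
          rw [hf nu hnA, h.tri m nu (fun hd => hnA (hcl m hm nu hd))]
          ring)
    have h2 : f = (f - cc m f • P m) + cc m f • P m := by abel
    rw [h2]
    apply Submodule.add_mem
    · refine Submodule.span_mono (Set.image_mono ?_) h1
      exact Finset.coe_subset.2 (Finset.erase_subset _ _)
    · exact Submodule.smul_mem _ _ (Submodule.subset_span ⟨m, hm, rfl⟩)

theorem Mac.span_of (h : Mac q t P) (p : Partition → Prop)
    (hp : ∀ nu nu', p nu → Partition.Dominates nu nu' → p nu') (f : Sym F)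
    (hf : ∀ nu, ¬ p nu → cc nu f = 0) : f ∈ Submodule.span F (P '' {nu | p nu}) := by
  classical
  obtain ⟨D, hD⟩ := exists_wt_bound f
  let A := (finite_size_le D).toFinset.filter p
  have hA : ∀ nu, nu ∈ A ↔ nu.size ≤ D ∧ p nu := by intro nu; simp [A]
  have h1 := h.elim A.card A rfl
    (by
      intro nu hnu nu' hd
      rw [hA] at hnu ⊢
      exact ⟨by rw [hd.1]; exact hnu.1, hp nu nu' hnu.2 hd⟩) f
    (by
      intro nu hnu
      by_contra hc
      obtain ⟨d, hd, hd'⟩ := cc_of_wt f nu hc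
      have := hD d hd
      rw [hA] at hnu
      exact hc (hf nu (fun hpn => hnu ⟨by omega, hpn⟩)))
  refine Submodule.span_mono (Set.image_mono ?_) h1
  intro nu hnu
  exact ((hA nu).1 hnu).2

theorem Mac.span_top (h : Mac q t P) : ⊤ ≤ Submodule.span F (Set.range P) := by
  intro f _
  have := h.span_of (fun _ => True) (fun _ _ _ _ => trivial) f (fun _ hn => absurd trivial hn)
  exact Submodule.span_mono (Set.image_subset_range _ _) this

theorem Mac.ext (h : Mac q t P) (f : Sym F) (hf : ∀ lam, bq q t f (P lam) = 0) : f = 0 := by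
  apply ip_nondeg (wqt q t) (wqt_ne h.gen)
  intro g
  have hg := h.span_top (Submodule.mem_top (x := g))
  induction hg using Submodule.span_induction with
  | mem x hx => obtain ⟨lam, rfl⟩ := hx; exact hf lam
  | zero => simp
  | add x y _ _ hx hy => rw [map_add, hx, hy, add_zero]
  | smul c x _ hx => rw [map_smul, hx, smul_zero]

theorem Mac.norm_ne (h : Mac q t P) (lam : Partition) : bq q t (P lam) (P lam) ≠ 0 := by
  intro h0
  apply h.ne lam
  apply h.ext
  intro mu
  by_cases hm : lam = mu
  · subst hm; exact h0
  · exact h.orth _ _ hm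

theorem Mac.li (h : Mac q t P) : LinearIndependent F P := by
  rw [linearIndependent_iff']
  intro s g hg i hi
  have h1 := congrArg (fun x => bq q t x (P i)) hg
  simp only [map_sum, LinearMap.sum_apply, map_smul, LinearMap.smul_apply, map_zero,
    LinearMap.zero_apply] at h1
  rw [Finset.sum_eq_single i] at h1
  · exact (mul_eq_zero.1 h1).resolve_right (h.norm_ne i)
  · intro j _ hj
    rw [h.orth j i hj, smul_zero]
  · intro hc; exact absurd hi hc

/-- the Macdonald basis. -/
def Mac.b (h : Mac q t P) : Module.Basis Partition F (Sym F) := Module.Basis.mk h.li h.span_top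

theorem Mac.b_apply (h : Mac q t P) (lam : Partition) : h.b lam = P lam :=
  Module.Basis.mk_apply _ _ _

theorem Mac.bq_P (h : Mac q t P) (f : Sym F) (lam : Partition) :
    bq q t f (P lam) = h.b.repr f lam * bq q t (P lam) (P lam) := by
  have e : (LinearMap.flip (bq q t) (P lam)) =
      (bq q t (P lam) (P lam)) • (h.b.coord lam) := by
    classical
    apply h.b.ext
    intro mu
    rw [LinearMap.smul_apply, Module.Basis.coord_apply, Module.Basis.repr_self, LinearMap.flip_apply,
      h.b_apply]
    by_cases hm : mu = lam
    · subst hm; simp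
    · rw [h.orth mu lam hm, Finsupp.single_apply, if_neg hm, smul_zero]
  have := congrArg (fun l => l f) e
  simp only [LinearMap.flip_apply, LinearMap.smul_apply, Module.Basis.coord_apply, smul_eq_mul] at this
  rw [this, mul_comm]

theorem Mac.repr_eq (h : Mac q t P) (f : Sym F) (lam : Partition) :
    h.b.repr f lam = bq q t f (P lam) / bq q t (P lam) (P lam) := by
  rw [h.bq_P f lam, mul_div_cancel_right₀ _ (h.norm_ne lam)]

theorem Mac.HH_P (h : Mac q t P) (lam : Partition) : HH (P lam) lam := by
  intro nu hnu
  apply h.tri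
  intro hd
  exact absurd (key_le_of_dominates hd) (not_le.2 hnu)

theorem Mac.orth_of_HH (h : Mac q t P) (f : Sym F) (lam : Partition) (hf : HH f lam)
    (mu : Partition) (hmu : key lam < key mu) : bq q t f (P mu) = 0 := by
  have h1 := h.span_of (fun nu => key nu ≤ key lam)
    (fun nu nu' h1 h2 => le_trans (key_le_of_dominates h2) h1) f (fun nu hn => hf nu (not_le.1 hn))
  clear hf
  induction h1 using Submodule.span_induction with
  | mem x hx =>
    obtain ⟨nu, hnu, rfl⟩ := hx
    apply h.orth
    rintro rfl
    exact absurd hnu (not_le.2 hmu)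
  | zero => simp
  | add x y _ _ hx hy => rw [map_add, LinearMap.add_apply, hx, hy, add_zero]
  | smul c x _ hx => rw [map_smul, LinearMap.smul_apply, hx, smul_zero]

theorem Mac.eq_smul (h : Mac q t P) (f : Sym F) (lam : Partition)
    (hf : ∀ mu, mu ≠ lam → bq q t f (P mu) = 0) : f = cc lam f • P lam := by
  have h1 : f = h.b.repr f lam • P lam := by
    rw [← sub_eq_zero]
    apply h.ext
    intro mu
    rw [map_sub, LinearMap.sub_apply, map_smul, LinearMap.smul_apply, smul_eq_mul]
    by_cases hm : mu = lam
    · subst hm; rw [h.bq_P, sub_self]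
    · rw [hf mu hm, h.orth lam mu (Ne.symm hm)]; ring
  have h2 := congrArg (cc lam) h1
  rw [cc_smul, h.diag, mul_one] at h2
  rw [h2]; exact h1

theorem Mac.eta_P (h : Mac q t P) (lam : Partition) : eta q t (P lam) = eps q t lam • P lam := by
  have h1 := h.eq_smul (eta q t (P lam)) lam (by
    intro mu hmu
    rcases lt_trichotomy (key lam) (key mu) with h2 | h2 | h2
    · exact h.orth_of_HH _ lam (HH_eta q t lam _ (h.HH_P lam)) mu h2
    · exact absurd (key_injective h2).symm hmu
    · rw [eta_symm h.gen, bq, ip_symm]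
      exact h.orth_of_HH _ mu (HH_eta q t mu _ (h.HH_P mu)) lam h2)
  rw [h1, cc_eta q t lam _ (h.HH_P lam), h.diag, mul_one]

theorem Mac.repr_eta (h : Mac q t P) (f : Sym F) (lam : Partition) :
    h.b.repr (eta q t f) lam = eps q t lam * h.b.repr f lam := by
  rw [h.repr_eq, h.repr_eq, eta_symm h.gen, h.eta_P, map_smul, smul_eq_mul, mul_div_assoc]

theorem Mac.top_zero (h : Mac q t P) (lam : Partition) (N : ℕ) (hN : lam.part 0 < N) :
    S1 N (P lam) = 0 := HH_top (h.HH_P lam) N hN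

theorem Mac.top (h : Mac q t P) (lam : Partition) : S1 (lam.part 0) (P lam) = P lam.tail := by
  have h1 := eta_top q t (P lam) (lam.part 0) (lam.part 0) (le_refl _) (h.top_zero lam)
  rw [h.eta_P, map_smul, eps_tail, add_smul, mul_smul] at h1
  have h2 := add_right_cancel h1
  have h3 : eta q t (S1 (lam.part 0) (P lam)) = eps q t lam.tail • S1 (lam.part 0) (P lam) := by
    have h4 := congrArg (fun x => t • x) h2
    simpa [smul_smul, h.gen.t0] using h4.symm
  have h5 := h.eq_smul (S1 (lam.part 0) (P lam)) lam.tail (by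
    intro mu hmu
    have h6 := congrArg (fun x => h.b.repr x mu) h3
    simp only [map_smul, Finsupp.smul_apply, smul_eq_mul, h.repr_eta] at h6
    rw [h.bq_P]
    have h7 : (eps q t mu - eps q t lam.tail) * h.b.repr (S1 (lam.part 0) (P lam)) mu = 0 := by
      rw [sub_mul, h6, sub_self]
    rw [(mul_eq_zero.1 h7).resolve_left (sub_ne_zero.2 (fun he => hmu (h.inj he))), zero_mul])
  rw [h5, ← cc_tail, h.diag, one_smul]

end BasisPart

section BoxPart
set_option linter.unusedSectionVars false
variable [CharZero F]

theorem T_one_eq (b : ℕ → F) (f : Sym F) : T b 1 f = b 0 • MvPolynomial.pderiv 0 f := by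
  induction f using sym_induction with
  | hC c => simp [T_C]
  | hadd f g hf hg => rw [map_add, hf, hg, map_add, smul_add]
  | hX n f hf =>
    rw [T_X_mul, hf, Derivation.leibniz, MvPolynomial.pderiv_X, Ts]
    by_cases h : n = 0
    · subst h
      simp [T_zero]
    · rw [if_neg (by omega)]
      simp [Pi.single_apply, h]

variable {q t : F} {P : Partition → Sym F}

theorem Mac.span_top_part (h : Mac q t P) (f : Sym F) (M : ℕ) (hf : ∀ N, M < N → S1 N f = 0) :
    f ∈ Submodule.span F (P '' {nu | nu.part 0 ≤ M}) := by
  apply h.span_of (fun nu => nu.part 0 ≤ M)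
  · intro nu nu' h1 h2
    have := h2.2 1
    simp [Partition.psum] at this
    omega
  · intro nu hn
    rw [cc_tail, hf _ (by omega), cc_zero]

theorem Mac.repr_zero_of_top (h : Mac q t P) (f : Sym F) (M : ℕ) (hf : ∀ N, M < N → S1 N f = 0)
    (mu : Partition) (hmu : M < mu.part 0) : h.b.repr f mu = 0 := by
  have h1 := h.span_top_part f M hf
  clear hf
  induction h1 using Submodule.span_induction with
  | mem x hx =>
    obtain ⟨nu, hnu, rfl⟩ := hx
    classical
    rw [← h.b_apply, Module.Basis.repr_self, Finsupp.single_apply, if_neg]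
    rintro rfl
    exact absurd hnu (not_le.2 hmu)
  | zero => simp
  | add x y _ _ hx hy => rw [map_add, Finsupp.add_apply, hx, hy, add_zero]
  | smul c x _ hx => rw [map_smul, Finsupp.smul_apply, hx, smul_zero]

theorem eq_of_tail {a b : Partition} (h0 : a.part 0 = b.part 0) (h : a.tail = b.tail) : a = b := by
  apply Partition.ext'
  intro j
  cases j with
  | zero => exact h0
  | succ j => rw [← Partition.tail_part, ← Partition.tail_part, h]

theorem Mac.repr_top (h : Mac q t P) (f : Sym F) (M : ℕ) (hf : ∀ N, M < N → S1 N f = 0)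
    (mu : Partition) (hmu : mu.part 0 = M) : h.b.repr f mu = h.b.repr (S1 M f) mu.tail := by
  have h1 := h.span_top_part f M hf
  clear hf
  induction h1 using Submodule.span_induction with
  | mem x hx =>
    obtain ⟨nu, hnu, rfl⟩ := hx
    classical
    rcases lt_or_eq_of_le (show nu.part 0 ≤ M from hnu) with h2 | h2
    · rw [h.top_zero nu M h2, ← h.b_apply, Module.Basis.repr_self, Finsupp.single_apply, if_neg]
      · simp
      · rintro rfl; omega
    · rw [← h2, h.top nu, ← h.b_apply, ← h.b_apply, Module.Basis.repr_self, Module.Basis.repr_self,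
        Finsupp.single_apply, Finsupp.single_apply]
      by_cases h3 : nu = mu
      · subst h3; simp
      · rw [if_neg h3, if_neg]
        intro h4
        exact h3 (eq_of_tail (by omega) h4)
  | zero => simp
  | add x y _ _ hx hy => rw [map_add, Finsupp.add_apply, hx, hy, map_add, map_add, Finsupp.add_apply]
  | smul c x _ hx => rw [map_smul, Finsupp.smul_apply, hx, map_smul, map_smul, Finsupp.smul_apply]

/-- `lam` is `mu` with a box added in row `i`. -/
def AddBox (mu lam : Partition) (i : ℕ) : Prop :=
  ∀ j, lam.part j = mu.part j + if j = i then 1 else 0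

theorem Mac.repr_X_iff (h : Mac q t P) (lam mu : Partition) :
    h.b.repr (MvPolynomial.X 0 * P mu) lam ≠ 0 ↔ h.b.repr (S1 1 (P lam)) mu ≠ 0 := by
  rw [h.repr_eq, h.repr_eq, T_one_eq, one_smul]
  have h1 := ip_X_mul (wqt q t) 0 (P mu) (P lam)
  rw [bq, h1, ip_symm _ (P mu)]
  have h2 := h.norm_ne lam
  have h3 := h.norm_ne mu
  have h4 := wqt_ne h.gen 0
  simp only [ne_eq, div_eq_zero_iff, mul_eq_zero]
  tauto

theorem Mac.box_aux (h : Mac q t P) (L : ℕ) : ∀ (lam : Partition) (_ : ∀ j, L ≤ j → lam.part j = 0)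
    (mu : Partition), h.b.repr (MvPolynomial.X 0 * P mu) lam ≠ 0 → ∃ i, AddBox mu lam i := by
  induction L with
  | zero =>
    intro lam hL mu hne
    rw [h.repr_X_iff, h.top_zero lam 1 (by rw [hL 0 (le_refl _)]; omega)] at hne
    simp at hne
  | succ L ih =>
    intro lam hL mu hne
    have hne' := (h.repr_X_iff lam mu).1 hne
    have hA : ∀ N, lam.part 0 < N → S1 N (S1 1 (P lam)) = 0 := by
      intro N hN
      rw [T_comm, h.top_zero lam N hN, map_zero]
    have hB : ∀ N, mu.part 0 + 1 < N → S1 N (MvPolynomial.X 0 * P mu) = 0 := by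
      intro N hN
      rw [T_X_mul, h.top_zero mu N (by omega), Ts, if_pos (by omega),
        h.top_zero mu (N - (0 + 1)) (by omega)]
      simp
    have h1 : mu.part 0 ≤ lam.part 0 := by
      by_contra hc
      exact hne' (h.repr_zero_of_top _ (lam.part 0) hA mu (by omega))
    have h2 : lam.part 0 ≤ mu.part 0 + 1 := by
      by_contra hc
      exact hne (h.repr_zero_of_top _ (mu.part 0 + 1) hB lam (by omega))
    by_cases h3 : mu.part 0 = lam.part 0
    · rw [h.repr_top _ _ hA mu h3, T_comm, h.top lam, ← h.repr_X_iff] at hne'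
      obtain ⟨i, hi⟩ := ih lam.tail (fun j hj => hL (j + 1) (by omega)) mu.tail hne'
      refine ⟨i + 1, fun j => ?_⟩
      cases j with
      | zero => rw [if_neg (by omega)]; omega
      | succ j =>
        have := hi j
        rw [Partition.tail_part, Partition.tail_part] at this
        rw [this]
        simp
    · classical
      rw [h.repr_top _ _ hB lam (by omega), T_X_mul, h.top_zero mu _ (Nat.lt_succ_self _), Ts,
        if_pos (by omega), show mu.part 0 + 1 - (0 + 1) = mu.part 0 by omega, h.top mu, mul_zero, zero_add,
        one_smul, ← h.b_apply, Module.Basis.repr_self, Finsupp.single_apply] at hne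
      have h4 : mu.tail = lam.tail := by
        by_contra hc
        rw [if_neg hc] at hne
        exact hne rfl
      refine ⟨0, fun j => ?_⟩
      cases j with
      | zero => rw [if_pos rfl]; omega
      | succ j =>
        rw [← Partition.tail_part lam, ← Partition.tail_part mu, h4]
        simp

theorem Mac.box (h : Mac q t P) (lam mu : Partition)
    (hne : h.b.repr (MvPolynomial.X 0 * P mu) lam ≠ 0) : ∃ i, AddBox mu lam i := by
  obtain ⟨L, hL⟩ := lam.exists_bound
  exact h.box_aux L lam hL mu hne

/-- product over boxes. -/
def cprod (g : ℕ → ℕ → F) (mu : Partition) : F :=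
  ∏ j ∈ mu.part.support, ∏ c ∈ Finset.range (mu.part j), g j c

theorem exists_bound2 (mu lam : Partition) (i : ℕ) :
    ∃ L, (∀ j, L ≤ j → mu.part j = 0) ∧ (∀ j, L ≤ j → lam.part j = 0) ∧ i < L := by
  obtain ⟨L1, h1⟩ := mu.exists_bound
  obtain ⟨L2, h2⟩ := lam.exists_bound
  exact ⟨L1 + L2 + i + 1, fun j hj => h1 j (by omega), fun j hj => h2 j (by omega), by omega⟩

theorem cprod_box (g : ℕ → ℕ → F) (mu lam : Partition) (i : ℕ) (h : AddBox mu lam i) :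
    cprod g lam = g i (mu.part i) * cprod g mu := by
  obtain ⟨L, h1, h2, h3⟩ := exists_bound2 mu lam i
  unfold cprod
  rw [prod_support_eq mu L h1 (fun j m => ∏ c ∈ Finset.range m, g j c) (by simp),
    prod_support_eq lam L h2 (fun j m => ∏ c ∈ Finset.range m, g j c) (by simp)]
  have h4 : ∀ j ∈ Finset.range L, ∏ c ∈ Finset.range (lam.part j), g j c =
      (if j = i then g i (mu.part i) else 1) * ∏ c ∈ Finset.range (mu.part j), g j c := by
    intro j _
    rw [h j]
    split_ifs with hj
    · subst hj
      rw [Finset.prod_range_succ, mul_comm]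
    · rw [add_zero, one_mul]
  rw [Finset.prod_congr rfl h4, Finset.prod_mul_distrib, Finset.prod_ite_eq',
    if_pos (Finset.mem_range.2 h3)]

/-- content of a box. -/
def zbox (q t : F) (mu : Partition) (i : ℕ) : F := q ^ mu.part i * t⁻¹ ^ i

theorem qtPoch_eq (u : F) (mu : Partition) :
    qtPoch q t u mu = cprod (fun j c => 1 - u * (q ^ c * t⁻¹ ^ j)) mu := by
  unfold qtPoch cprod qPochN
  refine Finset.prod_congr rfl fun j _ => Finset.prod_congr rfl fun c _ => ?_
  beta_reduce
  rw [zpow_neg, zpow_natCast, inv_pow]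
  ring

theorem qtPoch_box (u : F) (mu lam : Partition) (i : ℕ) (h : AddBox mu lam i) :
    qtPoch q t u lam = (1 - u * zbox q t mu i) * qtPoch q t u mu := by
  rw [qtPoch_eq, qtPoch_eq, cprod_box _ mu lam i h]
  rfl

/-- product of contents. -/
def nab (q t : F) (mu : Partition) : F := cprod (fun j c => q ^ c * t⁻¹ ^ j) mu

theorem nab_box (mu lam : Partition) (i : ℕ) (h : AddBox mu lam i) :
    nab q t lam = zbox q t mu i * nab q t mu := by
  unfold nab
  rw [cprod_box _ mu lam i h]
  rfl

theorem nab_ne (hg : Gen q t) (mu : Partition) : nab q t mu ≠ 0 := by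
  unfold nab cprod
  refine Finset.prod_ne_zero_iff.2 fun j _ => Finset.prod_ne_zero_iff.2 fun c _ => ?_
  exact mul_ne_zero (pow_ne_zero _ hg.q0) (pow_ne_zero _ (inv_ne_zero hg.t0))

/-- the constant `(1 - 1/t)(q - 1)`. -/
def kap (q t : F) : F := (1 - t⁻¹) * (q - 1)

theorem kap_ne (hg : Gen q t) : kap q t ≠ 0 := by
  have h1 := hg.q1 0
  have h2 := hg.t1 0
  have h3 := hg.t0
  rw [zero_add, pow_one] at h1 h2
  refine mul_ne_zero ?_ ?_
  · intro h
    apply h2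
    have : t * (1 - t⁻¹) = 0 := by rw [h, mul_zero]
    rw [mul_sub, mul_inv_cancel₀ h3, mul_one] at this
    rw [← neg_sub, this, neg_zero]
  · intro h
    apply h1
    rw [← neg_sub, h, neg_zero]

theorem eps_box (mu lam : Partition) (i : ℕ) (h : AddBox mu lam i) :
    eps q t lam - eps q t mu = kap q t * zbox q t mu i := by
  obtain ⟨L, h1, h2, h3⟩ := exists_bound2 mu lam i
  rw [eps_range q t mu L h1, eps_range q t lam L h2]
  have h4 : ∀ j ∈ Finset.range L, t⁻¹ ^ j * (q ^ lam.part j - 1) =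
      t⁻¹ ^ j * (q ^ mu.part j - 1) + if j = i then (q - 1) * zbox q t mu i else 0 := by
    intro j _
    rw [h j]
    split_ifs with hj
    · subst hj
      rw [pow_succ, zbox]; ring
    · rw [add_zero, add_zero]
  rw [Finset.sum_congr rfl h4, Finset.sum_add_distrib, Finset.sum_ite_eq',
    if_pos (Finset.mem_range.2 h3), kap]
  ring

end BoxPart

section EntryPart
set_option linter.unusedSectionVars false
variable [CharZero F] {q t : F} {P : Partition → Sym F}

/-- linear endomorphisms of the ring of symmetric functions. -/
abbrev Op (F : Type*) [Field F] := Module.End F (Sym F)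

/-- matrix entries in the basis `P`. -/
def Mac.en (h : Mac q t P) (A : Op F) (lam mu : Partition) : F := h.b.repr (A (P mu)) lam

theorem Mac.op_ext (h : Mac q t P) (A B : Op F) (hAB : ∀ lam mu, h.en A lam mu = h.en B lam mu) :
    A = B := by
  apply h.b.ext
  intro mu
  rw [h.b_apply]
  apply h.b.repr.injective
  ext lam
  exact hAB lam mu

theorem Mac.en_add (h : Mac q t P) (A B : Op F) (lam mu : Partition) :
    h.en (A + B) lam mu = h.en A lam mu + h.en B lam mu := by
  simp [Mac.en]

theorem Mac.en_sub (h : Mac q t P) (A B : Op F) (lam mu : Partition) :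
    h.en (A - B) lam mu = h.en A lam mu - h.en B lam mu := by
  simp [Mac.en]

theorem Mac.en_neg (h : Mac q t P) (A : Op F) (lam mu : Partition) :
    h.en (-A) lam mu = - h.en A lam mu := by
  simp [Mac.en]

theorem Mac.en_smul (h : Mac q t P) (c : F) (A : Op F) (lam mu : Partition) :
    h.en (c • A) lam mu = c * h.en A lam mu := by
  simp [Mac.en]

theorem Mac.en_zero (h : Mac q t P) (lam mu : Partition) :
    h.en 0 lam mu = 0 := by
  simp [Mac.en]

theorem Mac.en_sum (h : Mac q t P) {ι : Type*} (s : Finset ι) (A : ι → Op F) (lam mu : Partition) :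
    h.en (∑ i ∈ s, A i) lam mu = ∑ i ∈ s, h.en (A i) lam mu := by
  simp [Mac.en, LinearMap.sum_apply, Finsupp.finsetSum_apply]

theorem Mac.en_one_ne (h : Mac q t P) (lam mu : Partition) (hne : h.en 1 lam mu ≠ 0) :
    lam = mu := by
  classical
  by_contra hc
  apply hne
  rw [Mac.en, Module.End.one_apply, ← h.b_apply, Module.Basis.repr_self,
    Finsupp.single_apply, if_neg (fun e => hc e.symm)]

theorem Mac.en_mul (h : Mac q t P) (A B : Op F) (lam mu : Partition) :
    h.en (A * B) lam mu = (h.b.repr (B (P mu))).sum fun nu c => c * h.en A lam nu := by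
  have h1 := h.b.linearCombination_repr (B (P mu))
  rw [Mac.en, Module.End.mul_apply]
  conv_lhs => rw [← h1]
  rw [Finsupp.linearCombination_apply, Finsupp.sum, Finsupp.sum, map_sum, map_sum,
    Finsupp.finsetSum_apply]
  refine Finset.sum_congr rfl fun nu _ => ?_
  rw [map_smul, map_smul, Finsupp.smul_apply, smul_eq_mul, h.b_apply]
  rfl

theorem Mac.en_mul_ne (h : Mac q t P) (A B : Op F) (lam mu : Partition)
    (hne : h.en (A * B) lam mu ≠ 0) : ∃ nu, h.en A lam nu ≠ 0 ∧ h.en B nu mu ≠ 0 := by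
  rw [h.en_mul, Finsupp.sum] at hne
  obtain ⟨nu, _, h2⟩ := Finset.exists_ne_zero_of_sum_ne_zero hne
  exact ⟨nu, right_ne_zero_of_mul h2, left_ne_zero_of_mul h2⟩

/-- diagonal operators. -/
def Mac.Dg (h : Mac q t P) (g : Partition → F) : Op F := h.b.constr F (fun mu => g mu • P mu)

theorem Mac.Dg_P (h : Mac q t P) (g : Partition → F) (mu : Partition) :
    h.Dg g (P mu) = g mu • P mu := by
  rw [Mac.Dg]
  conv_lhs => rw [← h.b_apply mu]
  rw [Module.Basis.constr_basis]

theorem Mac.repr_Dg (h : Mac q t P) (g : Partition → F) (f : Sym F) (lam : Partition) :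
    h.b.repr (h.Dg g f) lam = g lam * h.b.repr f lam := by
  classical
  have e : (h.b.coord lam) ∘ₗ (h.Dg g) = g lam • h.b.coord lam := by
    apply h.b.ext
    intro mu
    rw [LinearMap.comp_apply, LinearMap.smul_apply, h.b_apply, h.Dg_P, map_smul, ← h.b_apply,
      Module.Basis.coord_apply, Module.Basis.repr_self, Finsupp.single_apply]
    by_cases hm : mu = lam
    · subst hm; rfl
    · simp [hm]
  exact LinearMap.congr_fun e f

theorem Mac.en_Dg_left (h : Mac q t P) (g : Partition → F) (A : Op F) (lam mu : Partition) :
    h.en (h.Dg g * A) lam mu = g lam * h.en A lam mu := h.repr_Dg g _ lam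

theorem Mac.en_Dg_right (h : Mac q t P) (g : Partition → F) (A : Op F) (lam mu : Partition) :
    h.en (A * h.Dg g) lam mu = g mu * h.en A lam mu := by
  rw [Mac.en, Module.End.mul_apply, h.Dg_P, map_smul, map_smul, Finsupp.smul_apply, smul_eq_mul,
    Mac.en]

/-- Macdonald's operator as an element of `Op`. -/
def et (q t : F) : Op F := eta q t

theorem Mac.en_et_left (h : Mac q t P) (A : Op F) (lam mu : Partition) :
    h.en (et q t * A) lam mu = eps q t lam * h.en A lam mu := h.repr_eta _ lam

theorem Mac.en_et_right (h : Mac q t P) (A : Op F) (lam mu : Partition) :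
    h.en (A * et q t) lam mu = eps q t mu * h.en A lam mu := by
  rw [Mac.en, Module.End.mul_apply, et, h.eta_P, map_smul, map_smul, Finsupp.smul_apply,
    smul_eq_mul, Mac.en]

theorem Mac.Dg_mul (h : Mac q t P) (g g' : Partition → F) (hg : ∀ mu, g mu * g' mu = 1) :
    h.Dg g * h.Dg g' = 1 := by
  apply h.b.ext
  intro mu
  rw [h.b_apply, Module.End.mul_apply, h.Dg_P, map_smul, h.Dg_P, smul_smul, mul_comm, hg, one_smul,
    Module.End.one_apply]

/-- conjugation by a diagonal operator. -/
def Mac.cj (h : Mac q t P) (g : Partition → F) (hg : ∀ mu, g mu ≠ 0) : Op F →+* Op F where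
  toFun A := h.Dg g * A * h.Dg (fun mu => (g mu)⁻¹)
  map_one' := by
    rw [mul_one]; exact h.Dg_mul _ _ (fun mu => mul_inv_cancel₀ (hg mu))
  map_mul' A B := by
    have := h.Dg_mul (fun mu => (g mu)⁻¹) g (fun mu => inv_mul_cancel₀ (hg mu))
    rw [show h.Dg g * A * h.Dg (fun mu => (g mu)⁻¹) * (h.Dg g * B * h.Dg (fun mu => (g mu)⁻¹)) =
      h.Dg g * A * (h.Dg (fun mu => (g mu)⁻¹) * h.Dg g) * B * h.Dg (fun mu => (g mu)⁻¹) by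
        simp only [mul_assoc], this, mul_one, mul_assoc (h.Dg g) A B]
  map_zero' := by rw [mul_zero, zero_mul]
  map_add' A B := by rw [mul_add, add_mul]

theorem Mac.en_cj (h : Mac q t P) (g : Partition → F) (hg : ∀ mu, g mu ≠ 0) (A : Op F)
    (lam mu : Partition) : h.en (h.cj g hg A) lam mu = g lam * h.en A lam mu / g mu := by
  change h.en (h.Dg g * A * h.Dg (fun mu => (g mu)⁻¹)) lam mu = _
  rw [h.en_Dg_right, h.en_Dg_left, div_eq_inv_mul]

theorem Mac.cj_et (h : Mac q t P) (g : Partition → F) (hg : ∀ mu, g mu ≠ 0) :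
    h.cj g hg (et q t) = et q t := by
  apply h.op_ext
  intro lam mu
  rw [h.en_cj]
  by_cases hl : lam = mu
  · subst hl
    rw [mul_div_assoc, mul_div_cancel₀]
    exact hg lam
  · have : h.en (et q t) lam mu = 0 := by
      by_contra hc
      apply hl
      have h1 := h.en_et_left 1 lam mu
      rw [mul_one] at h1
      rw [h1] at hc
      exact h.en_one_ne _ _ (right_ne_zero_of_mul hc)
    rw [this]; simp

theorem Mac.cj_smul (h : Mac q t P) (g : Partition → F) (hg : ∀ mu, g mu ≠ 0) (c : F) (A : Op F) :
    h.cj g hg (c • A) = c • h.cj g hg A := by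
  apply h.op_ext
  intro lam mu
  rw [h.en_cj, h.en_smul, h.en_smul, h.en_cj]
  ring

/-- `1/(1-q^n)`. -/
def aq (q : F) : ℕ → F := fun n => (1 - q ^ (n + 1))⁻¹

/-- multiplication as a ring homomorphism. -/
def rho (F : Type*) [Field F] : Sym F →ₐ[F] Op F := Algebra.lmul F (Sym F)

theorem rho_apply (f g : Sym F) : rho F f g = f * g := rfl

theorem kk_aq (hg : Gen q t) (j : ℕ) :
    kk (aq q) (ss q) j = if j = 0 then 1 else if j = 1 then -1 else 0 := by
  refine kk_unique _ _ (fun j => if j = 0 then 1 else if j = 1 then -1 else 0) rfl ?_ j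
  intro j
  have h1 : ∀ n, aq q n * ss q n = -1 := by
    intro n
    have := hg.q1 n
    unfold aq ss
    field_simp
    ring
  simp only [h1]
  cases j with
  | zero => simp
  | succ j =>
    rw [Finset.sum_range_succ, Finset.sum_range_succ, Finset.sum_eq_zero]
    · simp
    · intro n hn
      rw [Finset.mem_range] at hn
      have h2 : j + 1 - n ≠ 0 := by omega
      have h3 : j + 1 - n ≠ 1 := by omega
      simp only [h2, h3, if_false, mul_zero]

theorem T_aq_mul (hg : Gen q t) (k l : ℕ) (f : Sym F) :
    T (ss q) l (K (aq q) (k + 1) * f) =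
      K (aq q) (k + 1) * T (ss q) l f - (if 1 ≤ l then K (aq q) k * T (ss q) (l - 1) f else 0) := by
  rw [T_mul]
  cases l with
  | zero =>
    simp [T_zero]
  | succ l =>
    rw [Finset.Nat.sum_antidiagonal_succ]
    rw [T_zero, if_pos (by omega), Nat.add_sub_cancel, sub_eq_add_neg]
    congr 1
    cases l with
    | zero =>
      simp [T_K, kk_aq hg, Ks]
    | succ l =>
      rw [Finset.Nat.sum_antidiagonal_succ, Finset.sum_eq_zero]
      · simp [T_K, kk_aq hg, Ks]
      · intro x _
        simp [T_K, kk_aq hg]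

theorem eta_aq (hg : Gen q t) (f : Sym F) : ∃ G : Sym F, ∀ k,
    eta q t (K (aq q) (k + 1) * f) = K (aq q) (k + 1) * eta q t f - K (aq q) k * G := by
  obtain ⟨N, hN⟩ := T_bound (ss q) f
  refine ⟨∑ l ∈ Finset.range N, K (hh t) (l + 1) * T (ss q) l f, fun k => ?_⟩
  rw [eta_eq q t f (N + 1) (fun j hj => hN j (by omega)),
    eta_eq q t (K (aq q) (k + 1) * f) (N + 1)]
  · rw [Finset.mul_sum, Finset.mul_sum]
    simp only [T_aq_mul hg, mul_sub]
    rw [Finset.sum_sub_distrib]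
    refine congrArg₂ (fun x y => x - y) ?_ ?_
    · refine Finset.sum_congr rfl fun l _ => ?_
      exact mul_left_comm _ _ _
    · rw [Finset.sum_range_succ']
      simp only [Nat.le_add_left, if_true, Nat.add_sub_cancel]
      rw [if_neg (by omega), mul_zero, add_zero]
      refine Finset.sum_congr rfl fun l _ => ?_
      exact mul_left_comm _ _ _
  · intro j hj
    rw [T_aq_mul hg, hN j (by omega), hN (j - 1) (by omega)]
    simp

/-- multiplication by `K (aq q) k`. -/
def mm (q : F) (k : ℕ) : Op F := rho F (K (aq q) k)

/-- `E = m_1 η - η m_1`. -/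
def EE (q t : F) : Op F := mm q 1 * et q t - et q t * mm q 1

theorem et_mm (hg : Gen q t) (k : ℕ) :
    et q t * mm q (k + 1) - mm q (k + 1) * et q t = - (mm q k * EE q t) := by
  apply LinearMap.ext
  intro f
  obtain ⟨G, hG⟩ := eta_aq hg f
  have h0 := hG 0
  have hk := hG k
  rw [K_zero, one_mul, zero_add] at h0
  have hE : EE q t f = G := by
    change K (aq q) 1 * eta q t f - eta q t (K (aq q) 1 * f) = G
    rw [h0]; ring
  change eta q t (K (aq q) (k + 1) * f) - K (aq q) (k + 1) * eta q t f = - (K (aq q) k * EE q t f)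
  rw [hE, hk]; ring

theorem K_one (a : ℕ → F) : K a 1 = a 0 • (MvPolynomial.X 0 : Sym F) := by
  have := K_euler a 1
  simpa [K_zero] using this

theorem Mac.en_mm_one (h : Mac q t P) (lam mu : Partition) (hne : h.en (mm q 1) lam mu ≠ 0) :
    ∃ i, AddBox mu lam i := by
  apply h.box
  intro h0
  apply hne
  rw [Mac.en, mm, rho_apply, K_one, smul_mul_assoc, map_smul, Finsupp.smul_apply, h0, smul_zero]

theorem Mac.en_EE (h : Mac q t P) (lam mu : Partition) :
    h.en (EE q t) lam mu = (eps q t mu - eps q t lam) * h.en (mm q 1) lam mu := by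
  rw [EE, h.en_sub, h.en_et_left, h.en_et_right]; ring

end EntryPart

section FivePart
set_option linter.unusedSectionVars false
variable [CharZero F] {q t : F} {P : Partition → Sym F}

theorem op_neg_mul (A B : Op F) : (-A) * B = -(A * B) := neg_mul A B

theorem op_mul_neg (A B : Op F) : A * (-B) = -(A * B) := mul_neg A B

theorem op_smul_sub (c : F) (A B : Op F) : c • (A - B) = c • A - c • B := smul_sub c A B

theorem op_neg_smul (c : F) (A : Op F) : (-c) • A = -(c • A) := neg_smul c A

theorem op_smul_neg (c : F) (A : Op F) : c • (-A) = -(c • A) := smul_neg c A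

theorem ps_neg_mul_C (A : PowerSeries (Op F)) (B : Op F) (v : F) :
    -(A * PowerSeries.C ((-v) • B)) = A * PowerSeries.C (v • B) := by
  have h1 : PowerSeries.C ((-v) • B) + PowerSeries.C (v • B) = 0 := by
    rw [← map_add, ← add_smul, neg_add_cancel, zero_smul, map_zero]
  have h2 : A * PowerSeries.C ((-v) • B) + A * PowerSeries.C (v • B) = 0 := by
    rw [← mul_add, h1, mul_zero]
  exact neg_eq_of_add_eq_zero_right h2

/-- generating series of `K a k`. -/
def Ker (a : ℕ → F) : PowerSeries (Sym F) := PowerSeries.mk (K a)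

theorem Ker_add (a b : ℕ → F) : Ker (fun n => a n + b n) = Ker a * Ker b := by
  ext1 k
  rw [PowerSeries.coeff_mul, Ker, PowerSeries.coeff_mk, K_add]
  refine Finset.sum_congr rfl fun x _ => ?_
  rw [Ker, Ker, PowerSeries.coeff_mk, PowerSeries.coeff_mk]

theorem Ker_zero : Ker (fun _ => (0 : F)) = 1 := by
  ext1 k
  rw [Ker, PowerSeries.coeff_mk, PowerSeries.coeff_one]
  have := K_scale (0 : F) (fun _ => 0) k
  rw [show (fun n => (0 : F) ^ (n + 1) * (fun _ => (0 : F)) n) = fun _ => (0 : F) by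
    funext n; simp] at this
  rw [this]
  split_ifs with hk
  · subst hk; rw [pow_zero, one_smul, K_zero]
  · rw [zero_pow hk, zero_smul]

/-- the series for `x^n/(1-q^n)`. -/
def kr (q x : F) : PowerSeries (Sym F) := Ker (fun n => x ^ (n + 1) * aq q n)

/-- the inverse series. -/
def krb (q x : F) : PowerSeries (Sym F) := Ker (fun n => - (x ^ (n + 1) * aq q n))

theorem kr_krb (q x : F) : kr q x * krb q x = 1 := by
  rw [kr, krb, ← Ker_add, ← Ker_zero]
  congr 1
  funext n
  ring

/-- series of multiplication operators. -/
def Psi (F : Type*) [Field F] : PowerSeries (Sym F) →+* PowerSeries (Op F) :=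
  PowerSeries.map (rho F).toRingHom

theorem coeff_Psi (f : PowerSeries (Sym F)) (k : ℕ) :
    PowerSeries.coeff k (Psi F f) = rho F (PowerSeries.coeff k f) := by
  rw [Psi, PowerSeries.coeff_map]; rfl

theorem coeff_Psi_kr (x : F) (k : ℕ) :
    PowerSeries.coeff k (Psi F (kr q x)) = x ^ k • mm q k := by
  rw [coeff_Psi, kr, Ker, PowerSeries.coeff_mk, K_scale, map_smul, mm]

/-- operator series raising degree. -/
def Mac.Rs (h : Mac q t P) (Y : PowerSeries (Op F)) : Prop :=
  ∀ k lam mu, h.en (PowerSeries.coeff k Y) lam mu ≠ 0 → lam.size = mu.size + k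

theorem Mac.Rs_mul (h : Mac q t P) {Y Z : PowerSeries (Op F)} (hY : h.Rs Y) (hZ : h.Rs Z) :
    h.Rs (Y * Z) := by
  intro k lam mu hne
  rw [PowerSeries.coeff_mul, h.en_sum] at hne
  obtain ⟨x, hx, hx'⟩ := Finset.exists_ne_zero_of_sum_ne_zero hne
  rw [Finset.HasAntidiagonal.mem_antidiagonal] at hx
  obtain ⟨nu, h1, h2⟩ := h.en_mul_ne _ _ _ _ hx'
  have := hY _ _ _ h1
  have := hZ _ _ _ h2
  omega

theorem Mac.Rs_cj (h : Mac q t P) {Y : PowerSeries (Op F)} (hY : h.Rs Y) (g : Partition → F)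
    (hg : ∀ mu, g mu ≠ 0) : h.Rs (PowerSeries.map (h.cj g hg) Y) := by
  intro k lam mu hne
  rw [PowerSeries.coeff_map, h.en_cj] at hne
  apply hY
  intro h0
  rw [h0] at hne
  simp at hne

theorem Mac.en_homog (h : Mac q t P) (f : Sym F) (k : ℕ) (hf : Homog k f) (lam mu : Partition)
    (hne : h.en (rho F f) lam mu ≠ 0) : lam.size = mu.size + k := by
  by_contra hc
  apply hne
  rw [Mac.en, rho_apply, h.repr_eq, bq, ip_homog _ (Homog_mul hf (h.hom mu)) (h.hom lam) (by omega),
    zero_div]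

theorem Mac.Rs_Ker (h : Mac q t P) (a : ℕ → F) : h.Rs (Psi F (Ker a)) := by
  intro k lam mu hne
  rw [coeff_Psi, Ker, PowerSeries.coeff_mk] at hne
  exact h.en_homog _ k (Homog_K a k) lam mu hne

theorem Mac.uniq (h : Mac q t P) (Y Z : PowerSeries (Op F)) (W : Op F) (hY : h.Rs Y) (hZ : h.Rs Z)
    (h0 : PowerSeries.coeff 0 Y = PowerSeries.coeff 0 Z)
    (eY : PowerSeries.C (et q t) * Y - Y * PowerSeries.C (et q t) =
      - (PowerSeries.X * Y * PowerSeries.C W))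
    (eZ : PowerSeries.C (et q t) * Z - Z * PowerSeries.C (et q t) =
      - (PowerSeries.X * Z * PowerSeries.C W)) : Y = Z := by
  ext1 k
  induction k with
  | zero => exact h0
  | succ k ih =>
    have e1 := congrArg (PowerSeries.coeff (k + 1)) eY
    have e2 := congrArg (PowerSeries.coeff (k + 1)) eZ
    rw [map_sub, map_neg, PowerSeries.coeff_C_mul, PowerSeries.coeff_mul_C,
      PowerSeries.coeff_mul_C, PowerSeries.coeff_succ_X_mul] at e1 e2
    rw [ih, ← e2] at e1
    apply h.op_ext
    intro lam mu
    by_cases hs : lam.size = mu.size + (k + 1)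
    · have e3 := congrArg (fun A => h.en A lam mu) e1
      simp only [h.en_sub, h.en_et_left, h.en_et_right] at e3
      have hne : eps q t lam - eps q t mu ≠ 0 := by
        intro h1
        have := h.inj (sub_eq_zero.1 h1)
        subst this
        omega
      apply mul_left_cancel₀ hne
      linear_combination e3
    · have h1 : h.en (PowerSeries.coeff (k + 1) Y) lam mu = 0 := by
        by_contra hc; exact hs (hY _ _ _ hc)
      have h2 : h.en (PowerSeries.coeff (k + 1) Z) lam mu = 0 := by
        by_contra hc; exact hs (hZ _ _ _ hc)
      rw [h1, h2]

theorem comm_Psi_kr (hg : Gen q t) (x : F) :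
    PowerSeries.C (et q t) * Psi F (kr q x) - Psi F (kr q x) * PowerSeries.C (et q t) =
      - (PowerSeries.X * Psi F (kr q x) * PowerSeries.C (x • EE q t)) := by
  ext1 k
  rw [map_sub, map_neg, PowerSeries.coeff_C_mul, PowerSeries.coeff_mul_C,
      PowerSeries.coeff_mul_C]
  cases k with
  | zero =>
    rw [PowerSeries.coeff_zero_X_mul, coeff_Psi_kr, mm, K_zero, map_one]
    simp
  | succ k =>
    rw [PowerSeries.coeff_succ_X_mul, coeff_Psi_kr, coeff_Psi_kr, mul_smul_comm, smul_mul_assoc,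
      ← op_smul_sub, et_mm hg, smul_mul_assoc, mul_smul_comm, smul_smul, op_smul_neg, pow_succ]

/-- conjugation by the product of contents. -/
def Mac.cn (h : Mac q t P) : Op F →+* Op F := h.cj (nab q t) (nab_ne h.gen)

/-- conjugated multiplication series. -/
def Mac.Phi (h : Mac q t P) : PowerSeries (Sym F) →+* PowerSeries (Op F) :=
  (PowerSeries.map h.cn).comp (Psi F)

theorem Mac.Rs_Phi (h : Mac q t P) (a : ℕ → F) : h.Rs (h.Phi (Ker a)) :=
  h.Rs_cj (h.Rs_Ker a) _ (nab_ne h.gen)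

theorem Mac.cn_smul (h : Mac q t P) (c : F) (A : Op F) : h.cn (c • A) = c • h.cn A :=
  h.cj_smul _ _ c A

theorem Mac.EE_eq (h : Mac q t P) : EE q t = - (kap q t • h.cn (mm q 1)) := by
  apply h.op_ext
  intro lam mu
  rw [h.en_EE, h.en_neg, h.en_smul, Mac.cn, h.en_cj]
  by_cases h0 : h.en (mm q 1) lam mu = 0
  · rw [h0]; simp
  · obtain ⟨i, hi⟩ := h.en_mm_one _ _ h0
    rw [nab_box mu lam i hi]
    have h1 := nab_ne h.gen mu
    have h2 := eps_box (q := q) (t := t) mu lam i hi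
    field_simp
    linear_combination (-1 : F) * h2

theorem Mac.cj_EE (h : Mac q t P) (u : F) (hu : ∀ mu, qtPoch q t u mu ≠ 0) :
    h.cj (qtPoch q t u) hu (EE q t) = EE q t - u • h.cn (EE q t) := by
  apply h.op_ext
  intro lam mu
  rw [h.en_cj, h.en_sub, h.en_smul, Mac.cn, h.en_cj, h.en_EE]
  by_cases h0 : h.en (mm q 1) lam mu = 0
  · rw [h0]; simp
  · obtain ⟨i, hi⟩ := h.en_mm_one _ _ h0
    rw [nab_box mu lam i hi, qtPoch_box u mu lam i hi]
    have h1 := nab_ne h.gen mu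
    have h2 := hu mu
    field_simp

theorem Mac.EE_Phi (h : Mac q t P) (f : PowerSeries (Sym F)) :
    PowerSeries.C (EE q t) * h.Phi f = h.Phi f * PowerSeries.C (EE q t) := by
  ext1 k
  rw [PowerSeries.coeff_C_mul, PowerSeries.coeff_mul_C, Mac.Phi, RingHom.comp_apply,
    PowerSeries.coeff_map, coeff_Psi, h.EE_eq, op_neg_mul, op_mul_neg, smul_mul_assoc, mul_smul_comm,
    ← map_mul, ← map_mul, mm, ← map_mul, ← map_mul, mul_comm]

theorem Mac.comm_Phi (h : Mac q t P) (v : F) :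
    PowerSeries.C (et q t) * h.Phi (kr q (-v)) - h.Phi (kr q (-v)) * PowerSeries.C (et q t) =
      PowerSeries.X * h.Phi (kr q (-v)) * PowerSeries.C (v • h.cn (EE q t)) := by
  have h1 := congrArg (PowerSeries.map h.cn) (comm_Psi_kr h.gen (-v))
  rw [map_sub, map_neg, map_mul, map_mul, map_mul, map_mul, PowerSeries.map_X, PowerSeries.map_C,
    PowerSeries.map_C] at h1
  have h2 : h.cn (et q t) = et q t := h.cj_et _ _
  rw [h2, h.cn_smul] at h1
  exact h1.trans (ps_neg_mul_C _ _ _)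

theorem ring_aux {A : Type*} [Ring A] (e M N X E E2 : A) (hX : ∀ a : A, X * a = a * X)
    (eM : e * M - M * e = -(X * M * E)) (eN : e * N - N * e = X * N * E2) (EN : E * N = N * E) :
    e * (M * N) - M * N * e = -(X * (M * N) * (E - E2)) := by
  have h1 : e * (M * N) - M * N * e = (e * M - M * e) * N + M * (e * N - N * e) := by
    noncomm_ring
  rw [h1, eM, eN]
  have h2 : X * M * E * N = X * (M * N) * E := by
    rw [mul_assoc (X * M), EN]; noncomm_ring
  have h3 : M * (X * N * E2) = X * (M * N) * E2 := by
    rw [← mul_assoc, ← mul_assoc, ← hX M]; noncomm_ring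
  rw [neg_mul, h2, h3]
  noncomm_ring

theorem Mac.five (h : Mac q t P) (u : F) (hu : ∀ mu, qtPoch q t u mu ≠ 0) (x : F) :
    PowerSeries.map (h.cj (qtPoch q t u) hu) (Psi F (kr q x)) =
      Psi F (kr q x) * h.Phi (kr q (-(u * x))) := by
  apply h.uniq _ _ (x • EE q t - (u * x) • h.cn (EE q t))
  · exact h.Rs_cj (h.Rs_Ker _) _ _
  · exact h.Rs_mul (h.Rs_Ker _) (h.Rs_Phi _)
  · rw [PowerSeries.coeff_map, coeff_Psi_kr, PowerSeries.coeff_mul, Finset.Nat.antidiagonal_zero,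
      Finset.sum_singleton, coeff_Psi_kr, Mac.Phi,
      RingHom.comp_apply, PowerSeries.coeff_map, coeff_Psi_kr]
    simp [mm, K_zero]
  · have h1 := congrArg (PowerSeries.map (h.cj (qtPoch q t u) hu)) (comm_Psi_kr h.gen x)
    rw [map_sub, map_neg, map_mul, map_mul, map_mul, map_mul, PowerSeries.map_X, PowerSeries.map_C,
      PowerSeries.map_C, h.cj_et, h.cj_smul, h.cj_EE, smul_sub, smul_smul, mul_comm x u] at h1
    exact h1
  · rw [map_sub]
    apply ring_aux _ _ _ _ _ _ (fun a => (PowerSeries.commute_X a).symm.eq) (comm_Psi_kr h.gen x)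
      (h.comm_Phi (u * x))
    have h1 := h.EE_Phi (kr q (-(u * x)))
    have h2 : PowerSeries.C (x • EE q t) = x • PowerSeries.C (EE q t) := by
      ext1 k
      simp [PowerSeries.coeff_C]
    rw [h2, smul_mul_assoc, mul_smul_comm, h1]

theorem Mac.five_inv (h : Mac q t P) (u : F) (hu : ∀ mu, qtPoch q t u mu ≠ 0) (x : F) :
    PowerSeries.map (h.cj (qtPoch q t u) hu) (Psi F (krb q x)) =
      h.Phi (krb q (-(u * x))) * Psi F (krb q x) := by
  have h1 : PowerSeries.map (h.cj (qtPoch q t u) hu) (Psi F (krb q x)) *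
      PowerSeries.map (h.cj (qtPoch q t u) hu) (Psi F (kr q x)) = 1 := by
    rw [← map_mul, ← map_mul, mul_comm, kr_krb, map_one, map_one]
  have h2 : PowerSeries.map (h.cj (qtPoch q t u) hu) (Psi F (kr q x)) *
      (h.Phi (krb q (-(u * x))) * Psi F (krb q x)) = 1 := by
    rw [h.five, mul_assoc, ← mul_assoc (h.Phi (kr q (-(u * x)))), ← map_mul, kr_krb, map_one,
      one_mul, ← map_mul, kr_krb, map_one]
  exact left_inv_eq_right_inv h1 h2

/-- the series for `(x^n - y^n)/(1-q^n)`. -/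
def kd (q x y : F) : PowerSeries (Sym F) :=
  Ker (fun n => (x ^ (n + 1) - y ^ (n + 1)) / (1 - q ^ (n + 1)))

theorem kd_eq (q x y : F) : kd q x y = kr q x * krb q y := by
  rw [kr, krb, ← Ker_add, kd]
  congr 1
  funext n
  rw [aq]; ring

theorem Mac.master (h : Mac q t P) (a : F) (h1 : ∀ mu, qtPoch q t (a / t) mu ≠ 0)
    (h2 : ∀ mu, qtPoch q t a mu ≠ 0) (h3 : ∀ mu, qtPoch q t (a / q) mu ≠ 0) :
    PowerSeries.map (h.cj (qtPoch q t (a / t)) h1) (Psi F (kd q q 1)) *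
      PowerSeries.map (h.cj (qtPoch q t a) h2) (Psi F (kd q 1 (q / t))) =
    PowerSeries.map (h.cj (qtPoch q t (a / q)) h3) (Psi F (kd q q (q / t))) := by
  have hq := h.gen.q0
  have ht := h.gen.t0
  simp only [kd_eq, map_mul, h.five, h.five_inv]
  rw [mul_one, mul_one, div_mul_cancel₀ a hq, show a / q * (q / t) = a / t by field_simp,
    show a * (q / t) = a / t * q by ring]
  have c1 : Psi F (krb q 1) * Psi F (kr q 1) = 1 := by
    rw [← map_mul, mul_comm, kr_krb, map_one]
  have c2 : h.Phi (kr q (-(a / t * q))) * h.Phi (krb q (-(a / t))) * h.Phi (kr q (-a)) *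
      h.Phi (krb q (-(a / t * q))) = h.Phi (kr q (-a)) * h.Phi (krb q (-(a / t))) := by
    rw [← map_mul, ← map_mul, ← map_mul, ← map_mul]
    congr 1
    linear_combination (krb q (-(a / t)) * kr q (-a)) * kr_krb q (-(a / t * q))
  calc _ = Psi F (kr q q) * (h.Phi (kr q (-(a / t * q))) * h.Phi (krb q (-(a / t))) *
        (Psi F (krb q 1) * Psi F (kr q 1)) * h.Phi (kr q (-a)) *
          h.Phi (krb q (-(a / t * q)))) * Psi F (krb q (q / t)) := by simp only [mul_assoc]
    _ = _ := by rw [c1, mul_one, c2]; simp only [mul_assoc]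

end FivePart

section LinkPart
set_option linter.unusedSectionVars false
variable [CharZero F] {q t : F} {P : Partition → Sym F}

theorem AddBox.le {mu lam : Partition} {i : ℕ} (h : AddBox mu lam i) : mu ≤ lam := by
  intro j
  rw [h j]; omega

theorem Partition.le_trans' {a b c : Partition} (h1 : a ≤ b) (h2 : b ≤ c) : a ≤ c :=
  fun j => (h1 j).trans (h2 j)

theorem Partition.le_refl' (a : Partition) : a ≤ a := fun _ => le_refl _

theorem Partition.size_mono {a b : Partition} (h : a ≤ b) : a.size ≤ b.size := by
  obtain ⟨L, h1, h2, _⟩ := exists_bound2 a b 0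
  unfold Partition.size
  rw [Finsupp.sum, Finsupp.sum, sum_support_eq a L h1 (fun _ m => m) (fun _ => rfl),
    sum_support_eq b L h2 (fun _ m => m) (fun _ => rfl)]
  exact Finset.sum_le_sum fun j _ => h j

/-- operators whose nonzero entries respect containment. -/
def Mac.Ct (h : Mac q t P) (A : Op F) : Prop := ∀ lam mu, h.en A lam mu ≠ 0 → mu ≤ lam

theorem Mac.Ct_mul (h : Mac q t P) {A B : Op F} (hA : h.Ct A) (hB : h.Ct B) : h.Ct (A * B) := by
  intro lam mu hne
  obtain ⟨nu, h1, h2⟩ := h.en_mul_ne _ _ _ _ hne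
  exact Partition.le_trans' (hB _ _ h2) (hA _ _ h1)

theorem Mac.Ct_add (h : Mac q t P) {A B : Op F} (hA : h.Ct A) (hB : h.Ct B) : h.Ct (A + B) := by
  intro lam mu hne
  rw [h.en_add] at hne
  by_cases h0 : h.en A lam mu = 0
  · rw [h0, zero_add] at hne; exact hB _ _ hne
  · exact hA _ _ h0

theorem Mac.Ct_smul (h : Mac q t P) {A : Op F} (c : F) (hA : h.Ct A) : h.Ct (c • A) := by
  intro lam mu hne
  rw [h.en_smul] at hne
  exact hA _ _ (right_ne_zero_of_mul hne)

theorem Mac.Ct_one (h : Mac q t P) : h.Ct 1 := by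
  intro lam mu hne
  rw [h.en_one_ne _ _ hne]
  exact Partition.le_refl' _

theorem Mac.Ct_EE (h : Mac q t P) : h.Ct (EE q t) := by
  intro lam mu hne
  rw [h.en_EE] at hne
  obtain ⟨i, hi⟩ := h.en_mm_one _ _ (right_ne_zero_of_mul hne)
  exact hi.le

theorem Mac.Ct_mm (h : Mac q t P) (k : ℕ) : h.Ct (mm q k) := by
  induction k with
  | zero => rw [mm, K_zero, map_one]; exact h.Ct_one
  | succ k ih =>
    intro lam mu hne
    have e := congrArg (fun A => h.en A lam mu) (et_mm h.gen k)
    simp only [h.en_sub, h.en_et_left, h.en_et_right, h.en_neg] at e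
    apply h.Ct_mul ih h.Ct_EE
    intro h0
    rw [h0, neg_zero, ← sub_mul] at e
    rcases mul_eq_zero.1 e with h1 | h1
    · have h2 := h.inj (sub_eq_zero.1 h1)
      have h3 := h.en_homog _ _ (Homog_K (aq q) (k + 1)) lam mu hne
      subst h2
      omega
    · exact hne h1

theorem Mac.Ct_X (h : Mac q t P) (n : ℕ) : h.Ct (rho F (MvPolynomial.X n)) := by
  induction n using Nat.strong_induction_on with
  | _ n ih =>
  have h1 := K_euler (aq q) (n + 1)
  rw [Finset.sum_range_succ, Nat.sub_self, K_zero, mul_one] at h1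
  have h2 : aq q n ≠ 0 := inv_ne_zero (h.gen.q1 n)
  have h3 : (MvPolynomial.X n : Sym F) = (aq q n)⁻¹ • (((n + 1 : ℕ) : F) • K (aq q) (n + 1) +
      (-1 : F) • ∑ i ∈ Finset.range n,
        aq q i • (MvPolynomial.X i * K (aq q) (n + 1 - (i + 1)))) := by
    rw [h1, neg_one_smul, add_comm, ← add_assoc, neg_add_cancel, zero_add, smul_smul,
      inv_mul_cancel₀ h2, one_smul]
  rw [h3, map_smul, map_add, map_smul, map_smul, map_sum]
  refine h.Ct_smul _ (h.Ct_add (h.Ct_smul _ (h.Ct_mm _)) (h.Ct_smul _ ?_))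
  intro lam mu hne
  rw [h.en_sum] at hne
  obtain ⟨i, hi, hi'⟩ := Finset.exists_ne_zero_of_sum_ne_zero hne
  rw [map_smul, map_mul] at hi'
  exact h.Ct_smul _ (h.Ct_mul (ih i (Finset.mem_range.1 hi)) (h.Ct_mm _)) _ _ hi'

theorem Mac.Ct_rho (h : Mac q t P) (f : Sym F) : h.Ct (rho F f) := by
  induction f using sym_induction with
  | hC c =>
    rw [show (MvPolynomial.C c : Sym F) = c • 1 by rw [MvPolynomial.smul_eq_C_mul, mul_one],
      map_smul, map_one]
    exact h.Ct_smul _ h.Ct_one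
  | hadd f g hf hg => rw [map_add]; exact h.Ct_add hf hg
  | hX n f hf => rw [map_mul]; exact h.Ct_mul (h.Ct_X n) hf

theorem bq_K (hg : Gen q t) (A : ℕ → F) (k : ℕ) (f : Sym F) (hf : Homog k f) :
    bq q t f (K (fun n => A n * (1 - t ^ (n + 1)) / (1 - q ^ (n + 1))) k) =
      MvPolynomial.eval A f := by
  rw [bq, ip_apply, MvPolynomial.eval_eq]
  refine Finset.sum_congr rfl fun d hd => ?_
  rw [coeff_K, if_pos (hf d (MvPolynomial.mem_support_iff.1 hd)), mul_assoc]
  congr 1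
  rw [kc, wgt, Finsupp.prod, Finsupp.prod, ← Finset.prod_mul_distrib]
  refine Finset.prod_congr rfl fun n _ => ?_
  have h1 := hg.q1 n
  have h2 := hg.t1 n
  have h3 : ((d n).factorial : F) ≠ 0 := Nat.cast_ne_zero.2 (Nat.factorial_ne_zero _)
  have h4 : (n : F) + 1 ≠ 0 := Nat.cast_add_one_ne_zero n
  have h5 : A n = A n * (1 - t ^ (n + 1)) / (1 - q ^ (n + 1)) * wqt q t n / ((n : F) + 1) := by
    rw [wqt]; field_simp
  conv_rhs => rw [h5, div_pow, mul_pow]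
  have h6 : ((n : F) + 1) ^ d n ≠ 0 := pow_ne_zero _ h4
  rw [div_mul_eq_mul_div, div_eq_div_iff (mul_ne_zero h6 h3) h6]
  ring

theorem Mac.skew_eval (h : Mac q t P) (A : ℕ → F) (k : ℕ) (lam mu : Partition)
    (hk : lam.size = mu.size + k) :
    MvPolynomial.eval A (skewQ q t P lam mu) =
      h.en (rho F (K (fun n => A n * (1 - t ^ (n + 1)) / (1 - q ^ (n + 1))) k)) lam mu := by
  classical
  set Kk := K (fun n => A n * (1 - t ^ (n + 1)) / (1 - q ^ (n + 1))) k with hKk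
  let S := (finite_size_le k).toFinset
  have hS : ∀ nu, nu ∈ S ↔ nu.size ≤ k := by intro nu; simp [S]
  have c1 : ∀ nu, innerQT q t (macQ q t P lam) (P mu * P nu) = h.b.repr (P nu * P mu) lam := by
    intro nu
    rw [innerQT_bq, macQ, map_smul, LinearMap.smul_apply, bnorm, innerQT_bq, h.repr_eq, smul_eq_mul,
      mul_comm (P nu), bq, ip_symm _ (P mu * P nu), div_eq_inv_mul]
  have c2 : ∀ nu, nu ∉ S → innerQT q t (macQ q t P lam) (P mu * P nu) = 0 := by
    intro nu hnu
    rw [hS] at hnu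
    rw [c1, h.repr_eq, bq, ip_homog _ (Homog_mul (h.hom nu) (h.hom mu)) (h.hom lam) (by omega),
      zero_div]
  have c3 : skewQ q t P lam mu =
      ∑ nu ∈ S, innerQT q t (macQ q t P lam) (P mu * P nu) • macQ q t P nu := by
    rw [skewQ]
    apply finsum_eq_sum_of_support_subset
    intro nu hnu
    by_contra hc
    apply hnu
    beta_reduce
    rw [c2 nu hc, zero_smul]
  have d1 : ∀ nu, h.b.repr Kk nu = if nu.size = k then
      MvPolynomial.eval A (P nu) / bq q t (P nu) (P nu) else 0 := by
    intro nu
    rw [h.repr_eq, bq, ip_symm _ Kk]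
    split_ifs with hn
    · rw [bq_K h.gen A k (P nu) (hn ▸ h.hom nu)]
    · rw [ip_homog _ (h.hom nu) (Homog_K _ k) hn, zero_div]
  have d2 : Kk = ∑ nu ∈ S, h.b.repr Kk nu • P nu := by
    conv_lhs => rw [← h.b.linearCombination_repr Kk]
    rw [Finsupp.linearCombination_apply, Finsupp.sum]
    simp only [h.b_apply]
    apply Finset.sum_subset
    · intro nu hnu
      rw [hS]
      rw [Finsupp.mem_support_iff, d1] at hnu
      by_contra hc
      rw [if_neg (by omega)] at hnu
      exact hnu rfl
    · intro nu _ hnu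
      rw [Finsupp.notMem_support_iff.1 hnu, zero_smul]
  rw [c3, map_sum, Mac.en, rho_apply]
  conv_rhs => rw [d2]
  rw [Finset.sum_mul, map_sum, Finsupp.finsetSum_apply]
  refine Finset.sum_congr rfl fun nu hnu => ?_
  rw [MvPolynomial.smul_eval, smul_mul_assoc, LinearEquiv.map_smul, Finsupp.smul_apply,
    smul_eq_mul, ← c1 nu, d1, show macQ q t P nu = (bq q t (P nu) (P nu))⁻¹ • P nu by
      rw [macQ, bnorm, innerQT_bq], MvPolynomial.smul_eval]
  split_ifs with hn
  · rw [div_eq_inv_mul]; ring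
  · have : innerQT q t (macQ q t P lam) (P mu * P nu) = 0 := by
      rw [c1, h.repr_eq, bq, ip_homog _ (Homog_mul (h.hom nu) (h.hom mu)) (h.hom lam) (by omega),
      zero_div]
    rw [this]; ring

theorem Mac.en_mul_finset (h : Mac q t P) (A B : Op F) (lam mu : Partition) (S : Finset Partition)
    (hS : ∀ nu, h.en B nu mu ≠ 0 → nu ∈ S) :
    h.en (A * B) lam mu = ∑ nu ∈ S, h.en A lam nu * h.en B nu mu := by
  rw [h.en_mul, Finsupp.sum]
  rw [Finset.sum_congr rfl (fun nu _ => mul_comm _ _)]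
  apply Finset.sum_subset
  · intro nu hnu
    exact hS nu (Finsupp.mem_support_iff.1 hnu)
  · intro nu _ hnu
    rw [Finsupp.notMem_support_iff.1 hnu, mul_zero]

theorem Mac.pleth (h : Mac q t P) (x y : F) (k : ℕ) (lam mu : Partition)
    (hk : lam.size = mu.size + k) : plethAB t x y (skewQ q t P lam mu) =
      h.en (PowerSeries.coeff k (Psi F (kd q x y))) lam mu := by
  rw [plethAB, h.skew_eval _ k lam mu hk, coeff_Psi, kd, Ker, PowerSeries.coeff_mk]
  congr 4
  funext n
  rw [div_mul_cancel₀ _ (h.gen.t1 n)]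

theorem Mac.ks (h : Mac q t P) (k : ℕ) (lam mu : Partition)
    (hk : lam.size = mu.size + k) : (q / t) ^ k * ksM q t P lam mu =
      h.en (PowerSeries.coeff k (Psi F (kd q q (q / t)))) lam mu := by
  rw [ksM, h.skew_eval _ k lam mu hk, coeff_Psi, kd, Ker, PowerSeries.coeff_mk, ← h.en_smul,
    ← map_smul, ← K_scale]
  congr 4
  funext n
  have h1 := h.gen.q1 n
  have h2 := h.gen.t0
  rw [div_pow]
  field_simp
  ring

theorem Mac.final (h : Mac q t P) (a : F) (h1 : ∀ mu, qtPoch q t (a / t) mu ≠ 0)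
    (h2 : ∀ mu, qtPoch q t a mu ≠ 0) (h3 : ∀ mu, qtPoch q t (a / q) mu ≠ 0)
    (lam mu : Partition) (hle : mu ≤ lam) :
    ksM q t P lam mu =
      (t / q) ^ (lam.size - mu.size) *
        ((qtPoch q t (a / q) mu * qtPoch q t (a / t) lam) /
          (qtPoch q t a mu * qtPoch q t (a / q) lam)) *
        ∑ᶠ (nu : Partition) (_ : mu ≤ nu ∧ nu ≤ lam),
          (-1 : F) ^ (lam.size - nu.size) * (qtPoch q t a nu / qtPoch q t (a / t) nu) *
            vsM q t P lam nu * skHatM q t P nu mu := by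
  classical
  have hsz := Partition.size_mono hle
  obtain ⟨k, hk⟩ := Nat.exists_eq_add_of_le hsz
  let S := (finite_size_le lam.size).toFinset
  have hS : ∀ nu, nu ∈ S ↔ nu.size ≤ lam.size := by intro nu; simp [S]
  let T0 := S.filter (fun nu => mu ≤ nu ∧ nu ≤ lam)
  have hT : ∀ nu, nu ∈ T0 ↔ mu ≤ nu ∧ nu ≤ lam := by
    intro nu
    rw [Finset.mem_filter, hS]
    exact ⟨fun x => x.2, fun x => ⟨Partition.size_mono x.2, x⟩⟩
  let A := PowerSeries.map (h.cj (qtPoch q t (a / t)) h1) (Psi F (kd q q 1))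
  let B := PowerSeries.map (h.cj (qtPoch q t a) h2) (Psi F (kd q 1 (q / t)))
  have hA : h.Rs A := h.Rs_cj (h.Rs_Ker _) _ _
  have hB : h.Rs B := h.Rs_cj (h.Rs_Ker _) _ _
  have enA : ∀ i la nu, h.en (PowerSeries.coeff i A) la nu = qtPoch q t (a / t) la *
      h.en (PowerSeries.coeff i (Psi F (kd q q 1))) la nu / qtPoch q t (a / t) nu := by
    intro i la nu
    rw [PowerSeries.coeff_map, h.en_cj]
  have enB : ∀ i la nu, h.en (PowerSeries.coeff i B) la nu = qtPoch q t a la *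
      h.en (PowerSeries.coeff i (Psi F (kd q 1 (q / t)))) la nu / qtPoch q t a nu := by
    intro i la nu
    rw [PowerSeries.coeff_map, h.en_cj]
  have hm := congrArg (fun Y => h.en (PowerSeries.coeff k Y) lam mu) (h.master a h1 h2 h3)
  change h.en (PowerSeries.coeff k (A * B)) lam mu = h.en (PowerSeries.coeff k (PowerSeries.map
    (h.cj (qtPoch q t (a / q)) h3) (Psi F (kd q q (q / t))))) lam mu at hm
  rw [PowerSeries.coeff_map, h.en_cj, ← h.ks k lam mu hk, PowerSeries.coeff_mul, h.en_sum] at hm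
  have e1 : ∀ x ∈ Finset.HasAntidiagonal.antidiagonal k,
      h.en (PowerSeries.coeff x.1 A * PowerSeries.coeff x.2 B) lam mu =
        ∑ nu ∈ T0, h.en (PowerSeries.coeff x.1 A) lam nu * h.en (PowerSeries.coeff x.2 B) nu mu := by
    intro x hx
    rw [Finset.HasAntidiagonal.mem_antidiagonal] at hx
    rw [h.en_mul_finset _ _ lam mu S (by
      intro nu hnu
      rw [hS]
      have := hB _ _ _ hnu
      omega)]
    symm
    apply Finset.sum_filter_of_ne
    intro nu _ hne
    have n1 := left_ne_zero_of_mul hne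
    have n2 := right_ne_zero_of_mul hne
    rw [enA] at n1
    rw [enB] at n2
    rw [coeff_Psi] at n1 n2
    constructor
    · apply h.Ct_rho _ nu mu
      intro h0; rw [h0] at n2; simp at n2
    · apply h.Ct_rho _ lam nu
      intro h0; rw [h0] at n1; simp at n1
  rw [Finset.sum_congr rfl e1, Finset.sum_comm] at hm
  have e2 : ∀ nu ∈ T0, ∑ x ∈ Finset.HasAntidiagonal.antidiagonal k,
      h.en (PowerSeries.coeff x.1 A) lam nu * h.en (PowerSeries.coeff x.2 B) nu mu =
      (qtPoch q t (a / t) lam / qtPoch q t a mu) *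
      ((-1 : F) ^ (lam.size - nu.size) * (qtPoch q t a nu / qtPoch q t (a / t) nu) *
            vsM q t P lam nu * skHatM q t P nu mu) := by
    intro nu hnu
    rw [hT] at hnu
    have s1 := Partition.size_mono hnu.1
    have s2 := Partition.size_mono hnu.2
    rw [Finset.sum_eq_single (lam.size - nu.size, nu.size - mu.size)]
    · rw [enA, enB, vsM, skHatM, h.pleth q 1 (lam.size - nu.size) lam nu (by omega),
        h.pleth 1 (q / t) (nu.size - mu.size) nu mu (by omega)]
      have hs : (-1 : F) ^ (lam.size - nu.size) * (-1 : F) ^ ((lam.size : ℤ) - (nu.size : ℤ)) = 1 := by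
        rw [← Nat.cast_sub s2, zpow_natCast, ← mul_pow]; simp
      linear_combination (-(qtPoch q t (a / t) lam *
      h.en (PowerSeries.coeff (lam.size - nu.size) (Psi F (kd q q 1))) lam nu / qtPoch q t (a / t) nu) * (qtPoch q t a nu *
      h.en (PowerSeries.coeff (nu.size - mu.size) (Psi F (kd q 1 (q / t)))) nu mu / qtPoch q t a mu)) * hs
    · intro x _ hx
      by_contra hc
      apply hx
      have := hA _ _ _ (left_ne_zero_of_mul hc)
      have := hB _ _ _ (right_ne_zero_of_mul hc)
      ext <;> simp <;> omega
    · intro hx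
      exfalso
      apply hx
      rw [Finset.HasAntidiagonal.mem_antidiagonal]
      change lam.size - nu.size + (nu.size - mu.size) = k
      omega
  rw [Finset.sum_congr rfl e2, ← Finset.mul_sum] at hm
  have e3 : ∑ᶠ (nu : Partition) (_ : mu ≤ nu ∧ nu ≤ lam),
          (-1 : F) ^ (lam.size - nu.size) * (qtPoch q t a nu / qtPoch q t (a / t) nu) *
            vsM q t P lam nu * skHatM q t P nu mu =
      ∑ nu ∈ T0, (-1 : F) ^ (lam.size - nu.size) * (qtPoch q t a nu / qtPoch q t (a / t) nu) *
            vsM q t P lam nu * skHatM q t P nu mu := by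
    rw [← finsum_mem_finset_eq_sum]
    refine finsum_congr fun nu => ?_
    rw [hT]
  rw [e3, show lam.size - mu.size = k by omega]
  have hq := h.gen.q0
  have ht := h.gen.t0
  have g1 := h1 lam
  have g2 := h2 mu
  have g3 := h3 lam
  have g4 := h3 mu
  set Z := ∑ nu ∈ T0, (-1 : F) ^ (lam.size - nu.size) * (qtPoch q t a nu / qtPoch q t (a / t) nu) *
            vsM q t P lam nu * skHatM q t P nu mu
  have hqt : (t / q) ^ k * (q / t) ^ k = 1 := by
    rw [← mul_pow]
    rw [show t / q * (q / t) = 1 by field_simp, one_pow]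
  have hks : ksM q t P lam mu = (t / q) ^ k * ((q / t) ^ k * ksM q t P lam mu) := by
    rw [← mul_assoc, hqt, one_mul]
  rw [hks, mul_assoc ((t / q) ^ k)]
  congr 1
  field_simp at hm ⊢
  linear_combination (-1 : F) * hm

end LinkPart

section GenericPart
set_option linter.unusedSectionVars false

theorem aeval_inj {K L : Type*} [Field K] [Field L] [Algebra K L] {x : L}
    (hx : Transcendental K x) {p r : Polynomial K}
    (h : Polynomial.aeval x p = Polynomial.aeval x r) : p = r :=
  transcendental_iff_injective.mp hx h

theorem ratX_pow_ne (K : Type*) [Field K] (n : ℕ) :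
    (1 : RatFunc K) - RatFunc.X ^ (n + 1) ≠ 0 := by
  intro h
  have h2 : (1 : Polynomial K) = Polynomial.X ^ (n + 1) := by
    apply aeval_inj (RatFunc.transcendental_X (K := K))
    simpa [sub_eq_zero] using h
  have h3 := congrArg (fun p => Polynomial.coeff p 0) h2
  simp at h3

theorem ratX_lin_ne (K : Type*) [Field K] (d : K) :
    (1 : RatFunc K) - RatFunc.X * RatFunc.C d ≠ 0 := by
  intro h
  have h2 : (1 : Polynomial K) = Polynomial.X * Polynomial.C d := by
    apply aeval_inj (RatFunc.transcendental_X (K := K))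
    rw [map_one, map_mul, Polynomial.aeval_X, Polynomial.aeval_C, RatFunc.algebraMap_eq_C]
    exact sub_eq_zero.mp h
  have h3 := congrArg (fun p => Polynomial.coeff p 0) h2
  simp at h3

theorem charZero_rat (K : Type*) [Field K] [CharZero K] : CharZero (RatFunc K) :=
  charZero_of_injective_ringHom (RatFunc.C_injective (K := K))

theorem gen_q3_t3 : Gen q3 t3 := by
  have hc : Function.Injective (RatFunc.C (K := F2)) := RatFunc.C_injective
  have hc' : Function.Injective (RatFunc.C (K := F1)) := RatFunc.C_injective
  refine ⟨?_, ?_, fun n h => ?_, fun n h => ?_⟩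
  · exact (map_ne_zero _).mpr RatFunc.X_ne_zero
  · exact (map_ne_zero _).mpr ((map_ne_zero _).mpr RatFunc.X_ne_zero)
  · refine ratX_pow_ne F1 n (hc ?_)
    rw [map_sub, map_one, map_pow, map_zero]
    exact h
  · refine ratX_pow_ne ℚ n (hc' (hc ?_))
    simp only [map_sub, map_one, map_pow, map_zero]
    exact h

theorem eps_map {K L : Type*} [Field K] [Field L] (f : K →+* L) (q t : K) (mu : Partition) :
    eps (f q) (f t) mu = f (eps q t mu) := by
  unfold eps
  simp

theorem trans_X_inv (K : Type*) [Field K] : Transcendental K (RatFunc.X⁻¹ : RatFunc K) := by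
  intro h
  exact RatFunc.transcendental_X (K := K) (IsAlgebraic.inv_iff.mp h)

theorem inv_poly_inj (K : Type*) [Field K] {p r : Polynomial K}
    (h : p.eval₂ RatFunc.C (RatFunc.X⁻¹ : RatFunc K) = r.eval₂ RatFunc.C RatFunc.X⁻¹) : p = r := by
  apply aeval_inj (trans_X_inv K)
  rw [Polynomial.aeval_def, Polynomial.aeval_def, RatFunc.algebraMap_eq_C]
  exact h

theorem eps_inj2 : Function.Injective (eps q2 t2) := by
  intro lam mu h
  obtain ⟨L, hl, hm, -⟩ := exists_bound2 lam mu 0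
  rw [eps_range q2 t2 lam L hl, eps_range q2 t2 mu L hm] at h
  have ht : (1 : F2) - t2⁻¹ ≠ 0 := by
    intro h0
    have h1 : t2 = 1 := by
      rw [sub_eq_zero] at h0
      exact inv_eq_one.mp h0.symm
    have h2 : (1 : F1) - RatFunc.X ^ (0 + 1) = 0 := by
      apply RatFunc.C_injective (K := F1)
      rw [map_sub, map_one, map_pow, map_zero, zero_add, pow_one, sub_eq_zero]
      exact h1.symm
    exact ratX_pow_ne ℚ 0 h2
  have h3 := mul_left_cancel₀ ht (add_left_cancel h)
  simp only [mul_sub, mul_one, Finset.sum_sub_distrib] at h3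
  have h4 := sub_left_injective h3
  have h5 : ∑ j ∈ Finset.range L, Polynomial.C (t1⁻¹ ^ j) * Polynomial.X ^ lam.part j =
      ∑ j ∈ Finset.range L, Polynomial.C (t1⁻¹ ^ j) * Polynomial.X ^ mu.part j := by
    apply aeval_inj (RatFunc.transcendental_X (K := F1))
    simp only [map_sum, map_mul, map_pow, Polynomial.aeval_X, Polynomial.aeval_C,
      RatFunc.algebraMap_eq_C, map_inv₀]
    exact h4
  refine Partition.ext' ?_
  intro i
  by_cases hi : L ≤ i
  · rw [hl i hi, hm i hi]
  have hi' : i < L := not_le.mp hi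
  have h6 := congrArg (fun p => Polynomial.coeff p (lam.part i)) h5
  simp only [Polynomial.finsetSum_coeff, Polynomial.coeff_C_mul, Polynomial.coeff_X_pow] at h6
  have h7 : ∑ j ∈ Finset.range L, (Polynomial.C (if lam.part i = lam.part j then (1 : ℚ) else 0)) *
        Polynomial.X ^ j =
      ∑ j ∈ Finset.range L, (Polynomial.C (if lam.part i = mu.part j then (1 : ℚ) else 0)) *
        Polynomial.X ^ j := by
    apply inv_poly_inj ℚ
    simp only [Polynomial.eval₂_finsetSum, Polynomial.eval₂_mul, Polynomial.eval₂_pow,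
      Polynomial.eval₂_X, Polynomial.eval₂_C]
    refine Eq.trans ?_ (h6.trans ?_)
    · refine Finset.sum_congr rfl fun j _ => ?_
      split_ifs <;> simp [t1]
    · refine Finset.sum_congr rfl fun j _ => ?_
      split_ifs <;> simp [t1]
  have h8 := congrArg (fun p => Polynomial.coeff p i) h7
  simp only [Polynomial.finsetSum_coeff, Polynomial.coeff_C_mul, Polynomial.coeff_X_pow,
    mul_ite, mul_one, mul_zero, Finset.sum_ite_eq, Finset.mem_range, hi', if_true] at h8
  by_contra hne
  simp [hne] at h8

theorem eps_inj3 : Function.Injective (eps q3 t3) := by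
  intro lam mu h
  apply eps_inj2
  apply RatFunc.C_injective (K := F2)
  rw [← eps_map, ← eps_map]
  exact h

theorem qtPoch_ne3 (d : F2) (mu : Partition) : qtPoch q3 t3 (a3 * RatFunc.C d) mu ≠ 0 := by
  rw [qtPoch_eq]
  unfold cprod
  refine Finset.prod_ne_zero_iff.mpr fun j _ => Finset.prod_ne_zero_iff.mpr fun c _ => ?_
  have h := ratX_lin_ne F2 (d * (q2 ^ c * t2⁻¹ ^ j))
  rw [map_mul, map_mul, map_pow, map_pow, map_inv₀, ← mul_assoc] at h
  exact h

end GenericPart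

/-- Expansion of `ks` in terms of `vs` and `ŝk` with a free
parameter `a`: for partitions `μ ⊆ λ`,
`ks_{λ/μ}(q,t) = (t/q)^{|λ|-|μ|} ((a/q)_μ (a/t)_λ)/((a)_μ (a/q)_λ)
  ∑_ν (-1)^{|λ|-|ν|} ((a)_ν/(a/t)_ν) vs_{λ/ν}(q,t) ŝk_{ν/μ}(q,t)`,
the sum over partitions `ν` with `μ ⊆ ν ⊆ λ`. -/
theorem ks_expansion_with_parameter
    (P : Partition → Sym F3) (hP : IsMacdonald q3 t3 P)
    (lam mu : Partition) (h : mu ≤ lam) :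
    ksM q3 t3 P lam mu =
      (t3 / q3) ^ (lam.size - mu.size) *
        ((qtPoch q3 t3 (a3 / q3) mu * qtPoch q3 t3 (a3 / t3) lam) /
          (qtPoch q3 t3 a3 mu * qtPoch q3 t3 (a3 / q3) lam)) *
        ∑ᶠ (nu : Partition) (_ : mu ≤ nu ∧ nu ≤ lam),
          (-1 : F3) ^ (lam.size - nu.size) * (qtPoch q3 t3 a3 nu / qtPoch q3 t3 (a3 / t3) nu) *
            vsM q3 t3 P lam nu * skHatM q3 t3 P nu mu := by
  have c1 : CharZero F1 := charZero_rat ℚ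
  have c2 : CharZero F2 := charZero_rat F1
  have c3 : CharZero F3 := charZero_rat F2
  have e1 : a3 = a3 * RatFunc.C (1 : F2) := by rw [map_one, mul_one]
  have e2 : a3 / t3 = a3 * RatFunc.C (t2⁻¹) := by
    rw [map_inv₀, div_eq_mul_inv]
    rfl
  have e3 : a3 / q3 = a3 * RatFunc.C (q2⁻¹) := by
    rw [map_inv₀, div_eq_mul_inv]
    rfl
  refine Mac.final (Mac.of gen_q3_t3 eps_inj3 hP) a3 (fun m => ?_) (fun m => ?_) (fun m => ?_)
    lam mu h
  · rw [e2]
    exact qtPoch_ne3 _ m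
  · rw [e1]
    exact qtPoch_ne3 _ m
  · rw [e3]
    exact qtPoch_ne3 _ m

end SkewPieriFormalization
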